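/- Suppose the interaction range satisfies r_n/n^{3/4} → ∞ as n → ∞. Then, under the law μ_n, the rescaled magnetization S_n/n^{3/4} converges in distribution to the probability measure on ℝ with density x ↦ (√2/Γ(1/4))·exp(−x⁴/4) with respect to Lebesgue measure. -/

import Mathlib

open MeasureTheory ProbabilityTheory Real Filter Topology

noncomputable section

/-- The Hamiltonian of the model: each spin interacts with its `2r` nearest
neighbours on the discrete circle `ℤ/nℤ`. -/
def Ham (n r : ℕ) (x : Fin n → ℝ) : ℝ :=
  -(1 / (2 * (r : ℝ))) *
    ∑ i : Fin n, ∑ j ∈ Finset.Icc 1 r, x i * x ⟨((i : ℕ) + j) % n, Nat.mod_lt _ i.pos⟩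

/-- The self-adjusted temperature. -/
def Temp (n : ℕ) (x : Fin n → ℝ) : ℝ := (∑ i : Fin n, (x i) ^ 2) / n

/-- The magnetization. -/
def Mag (n : ℕ) (x : Fin n → ℝ) : ℝ := ∑ i : Fin n, x i

/-- The unnormalized measure `exp(-H_n/T_n) 1_{T_n>0} dν^{⊗n}`. -/
def preμ (n r : ℕ) : Measure (Fin n → ℝ) :=
  (Measure.pi fun _ : Fin n => (gaussianReal 0 1 : Measure ℝ)).withDensity
    fun x => if 0 < Temp n x then ENNReal.ofReal (Real.exp (-(Ham n r x) / Temp n x)) else 0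

/-- The probability measure `μ_n` of the model. -/
def μmeas (n r : ℕ) : Measure (Fin n → ℝ) := (preμ n r Set.univ)⁻¹ • preμ n r

/-- The standard Gaussian measure on `ℝᵐ`. -/
def stdGauss (m : ℕ) : Measure (Fin m → ℝ) := Measure.pi fun _ => gaussianReal 0 1

instance (m : ℕ) : IsProbabilityMeasure (stdGauss m) := by
  unfold stdGauss; infer_instance

/-- The squared Euclidean norm. -/
def normSq {m : ℕ} (w : Fin m → ℝ) : ℝ := ∑ i, w i ^ 2

lemma measurable_normSq {m : ℕ} : Measurable (normSq (m := m)) := by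
  unfold normSq; fun_prop

lemma normSq_nonneg {m : ℕ} (w : Fin m → ℝ) : 0 ≤ normSq w :=
  Finset.sum_nonneg fun _ _ => sq_nonneg _

lemma normSq_smul {m : ℕ} (c : ℝ) (w : Fin m → ℝ) : normSq (c • w) = c ^ 2 * normSq w := by
  simp [normSq, Finset.mul_sum, mul_pow]

lemma normSq_pos {m : ℕ} {w : Fin m → ℝ} (hw : w ≠ 0) : 0 < normSq w := by
  refine lt_of_le_of_ne (normSq_nonneg w) fun h => hw ?_
  have := (Finset.sum_eq_zero_iff_of_nonneg (fun i _ => sq_nonneg (w i))).1 h.symm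
  funext i
  simpa using this i (Finset.mem_univ i)

/-- The density of the standard Gaussian measure on `ℝᵐ`. -/
def stdGaussPDF (m : ℕ) (t : ℝ) : ℝ := (√(2 * π))⁻¹ ^ m * exp (-t / 2)

lemma stdGaussPDF_nonneg (m : ℕ) (t : ℝ) : 0 ≤ stdGaussPDF m t := by
  unfold stdGaussPDF; positivity

lemma stdGaussPDF_normSq {m : ℕ} (w : Fin m → ℝ) :
    stdGaussPDF m (normSq w) = ∏ i, gaussianPDFReal 0 1 (w i) := by
  simp only [stdGaussPDF, normSq, gaussianPDFReal, Finset.prod_mul_distrib, ← exp_sum]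
  simp [Finset.sum_div, neg_div]

lemma integrable_stdGaussPDF (m : ℕ) :
    Integrable (fun w : Fin m → ℝ => stdGaussPDF m (normSq w)) := by
  simp_rw [stdGaussPDF_normSq]
  exact Integrable.fintype_prod fun _ => integrable_gaussianPDFReal 0 1

lemma stdGauss_eq_withDensity (m : ℕ) :
    stdGauss m = volume.withDensity fun w => ENNReal.ofReal (stdGaussPDF m (normSq w)) := by
  refine Measure.pi_eq fun s hs => ?_
  rw [withDensity_apply _ (MeasurableSet.univ_pi hs),
    ← ofReal_integral_eq_lintegral_ofReal (integrable_stdGaussPDF m).integrableOn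
      (ae_of_all _ fun _ => stdGaussPDF_nonneg _ _),
    ← integral_indicator (MeasurableSet.univ_pi hs)]
  have h : (Set.univ.pi s).indicator (fun w : Fin m → ℝ => stdGaussPDF m (normSq w)) =
      fun w => ∏ i, (s i).indicator (gaussianPDFReal 0 1) (w i) := by
    funext w
    by_cases hw : w ∈ Set.univ.pi s
    · rw [Set.indicator_of_mem hw, stdGaussPDF_normSq]
      exact Finset.prod_congr rfl fun i _ =>
        (Set.indicator_of_mem (hw i (Set.mem_univ i)) _).symm
    · rw [Set.indicator_of_notMem hw]
      simp only [Set.mem_univ_pi, not_forall] at hw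
      obtain ⟨i, hi⟩ := hw
      exact (Finset.prod_eq_zero (Finset.mem_univ i) (Set.indicator_of_notMem hi _)).symm
  rw [h, integral_fintype_prod_volume_eq_prod,
    ENNReal.ofReal_prod_of_nonneg fun i _ => integral_nonneg fun x =>
      Set.indicator_nonneg (fun _ _ => gaussianPDFReal_nonneg _ _ _) _]
  refine Finset.prod_congr rfl fun i _ => ?_
  rw [integral_indicator (hs i), gaussianReal_apply_eq_integral 0 one_ne_zero]

/-- Integration in polar coordinates. -/
lemma lintegral_polar {E : Type*} [NormedAddCommGroup E] [NormedSpace ℝ E] [Nontrivial E]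
    [FiniteDimensional ℝ E] [MeasurableSpace E] [BorelSpace E] (μ : Measure E)
    [μ.IsAddHaarMeasure] (f : E → ENNReal) :
    ∫⁻ x, f x ∂μ = ∫⁻ p : Metric.sphere (0 : E) 1 × Set.Ioi (0 : ℝ), f ((p.2 : ℝ) • (p.1 : E))
      ∂(μ.toSphere.prod (Measure.volumeIoiPow (Module.finrank ℝ E - 1))) := by
  have hmp := μ.measurePreserving_homeomorphUnitSphereProd
  rw [← hmp.lintegral_comp_emb (Homeomorph.measurableEmbedding _)]
  calc ∫⁻ x, f x ∂μ = ∫⁻ x in ({0}ᶜ : Set E), f x ∂μ := by rw [restrict_compl_singleton]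
    _ = ∫⁻ x : ({0}ᶜ : Set E), f x ∂(μ.comap (↑)) :=
      (lintegral_subtype_comap (measurableSet_singleton _).compl _).symm
    _ = _ := by
      refine lintegral_congr fun x => ?_
      congr 1
      have := congrArg Subtype.val ((homeomorphUnitSphereProd E).symm_apply_apply x)
      rw [homeomorphUnitSphereProd_symm_apply_coe] at this
      exact this.symm

/-- A direction-dependent quantity and the squared norm are independent under the standard
Gaussian measure. -/
lemma indepFun_normSq {m : ℕ} (hm : 0 < m) {D : (Fin m → ℝ) → ℝ} (hD : Measurable D)
    (hhom : ∀ c : ℝ, 0 < c → ∀ w, D (c • w) = D w) : IndepFun D normSq (stdGauss m) := by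
  have : Nonempty (Fin m) := ⟨⟨0, hm⟩⟩
  set E := EuclideanSpace ℝ (Fin m)
  set σ := (volume : Measure E).toSphere
  set κ := Measure.volumeIoiPow (Module.finrank ℝ E - 1)
  have key : ∀ A B : Set ℝ, MeasurableSet A → MeasurableSet B →
      stdGauss m (D ⁻¹' A ∩ normSq ⁻¹' B) =
        (∫⁻ u : Metric.sphere (0 : E) 1, A.indicator 1 (D (WithLp.ofLp (u : E))) ∂σ) *
        ∫⁻ t : Set.Ioi (0 : ℝ), B.indicator 1 ((t : ℝ) ^ 2) *
          ENNReal.ofReal (stdGaussPDF m ((t : ℝ) ^ 2)) ∂κ := by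
    intro A B hA hB
    have hAB : MeasurableSet (D ⁻¹' A ∩ normSq ⁻¹' B) := (hD hA).inter (measurable_normSq hB)
    have hmeas : Measurable fun t : ℝ => ENNReal.ofReal (stdGaussPDF m t) := by
      unfold stdGaussPDF; fun_prop
    rw [← lintegral_prod_mul, stdGauss_eq_withDensity, withDensity_apply _ hAB,
      ← lintegral_indicator hAB,
      ← (PiLp.volume_preserving_ofLp (Fin m)).lintegral_comp
        (Measurable.indicator (f := fun w => ENNReal.ofReal (stdGaussPDF m (normSq w)))
          (hmeas.comp measurable_normSq) hAB), lintegral_polar]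
    · refine lintegral_congr fun p => ?_
      have ht : (0 : ℝ) < p.2 := p.2.2
      have h1 : D ((p.2 : ℝ) • WithLp.ofLp (p.1 : E)) = D (WithLp.ofLp (p.1 : E)) := hhom _ ht _
      have h2 : normSq (WithLp.ofLp (p.1 : E)) = 1 := by
        have : ‖(p.1 : E)‖ ^ 2 = 1 := by simp
        rw [EuclideanSpace.norm_sq_eq] at this
        simpa [normSq] using this
      have h3 : normSq ((p.2 : ℝ) • WithLp.ofLp (p.1 : E)) = (p.2 : ℝ) ^ 2 := by
        rw [normSq_smul, h2, mul_one]
      have h4 : WithLp.ofLp ((p.2 : ℝ) • (p.1 : E)) = (p.2 : ℝ) • WithLp.ofLp (p.1 : E) := rfl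
      rw [h4]
      by_cases ha : D (WithLp.ofLp (p.1 : E)) ∈ A
      · by_cases hb : (p.2 : ℝ) ^ 2 ∈ B
        · have : (p.2 : ℝ) • WithLp.ofLp (p.1 : E) ∈ D ⁻¹' A ∩ normSq ⁻¹' B :=
            ⟨by rwa [Set.mem_preimage, h1], by rwa [Set.mem_preimage, h3]⟩
          rw [Set.indicator_of_mem this, Set.indicator_of_mem ha, Set.indicator_of_mem hb, h3]
          simp
        · have : (p.2 : ℝ) • WithLp.ofLp (p.1 : E) ∉ D ⁻¹' A ∩ normSq ⁻¹' B :=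
            fun h => hb (by simpa only [Set.mem_preimage, h3] using h.2)
          rw [Set.indicator_of_notMem this, Set.indicator_of_notMem hb]
          simp
      · have : (p.2 : ℝ) • WithLp.ofLp (p.1 : E) ∉ D ⁻¹' A ∩ normSq ⁻¹' B :=
          fun h => ha (by simpa only [Set.mem_preimage, h1] using h.1)
        rw [Set.indicator_of_notMem this, Set.indicator_of_notMem ha]
        simp
    · refine Measurable.aemeasurable ?_
      exact ((measurable_one.indicator hA).comp hD).comp
        ((PiLp.volume_preserving_ofLp (Fin m)).measurable.comp measurable_subtype_coe)
    · refine Measurable.aemeasurable ?_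
      exact (((measurable_one.indicator hB).mul hmeas).comp
        (by fun_prop : Measurable fun t : Set.Ioi (0 : ℝ) => (t : ℝ) ^ 2))
  rw [indepFun_iff_measure_inter_preimage_eq_mul]
  intro A B hA hB
  have hu := key Set.univ Set.univ .univ .univ
  have ha := key A Set.univ hA .univ
  have hb := key Set.univ B .univ hB
  simp only [Set.preimage_univ, Set.inter_univ, Set.univ_inter, measure_univ] at hu ha hb
  rw [key A B hA hB, ha, hb, mul_mul_mul_comm, mul_comm (lintegral σ _) (lintegral σ _),
    mul_mul_mul_comm, ← hu, one_mul]

lemma integral_stdGauss {m : ℕ} (f : (Fin m → ℝ) → ℝ) :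
    ∫ w, f w ∂(stdGauss m) = ∫ w, stdGaussPDF m (normSq w) * f w := by
  rw [stdGauss_eq_withDensity, integral_withDensity_eq_integral_toReal_smul]
  · simp [stdGaussPDF_nonneg]
  · have : Measurable fun t : ℝ => ENNReal.ofReal (stdGaussPDF m t) := by
      unfold stdGaussPDF; fun_prop
    exact this.comp measurable_normSq
  · simp

/-- The law of the squared norm of a standard Gaussian vector in `ℝᵐ`. -/
def chiSq (m : ℕ) : Measure ℝ := (stdGauss m).map normSq

instance (m : ℕ) : IsProbabilityMeasure (chiSq m) :=
  Measure.isProbabilityMeasure_map measurable_normSq.aemeasurable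

lemma integral_chiSq {m : ℕ} {f : ℝ → ℝ} (hf : Measurable f) :
    ∫ t, f t ∂(chiSq m) = ∫ w, f (normSq w) ∂(stdGauss m) :=
  integral_map measurable_normSq.aemeasurable hf.aestronglyMeasurable

lemma integrable_chiSq_iff {m : ℕ} {f : ℝ → ℝ} (hf : Measurable f) :
    Integrable f (chiSq m) ↔ Integrable (fun w => f (normSq w)) (stdGauss m) :=
  integrable_map_measure hf.aestronglyMeasurable measurable_normSq.aemeasurable

lemma stdGauss_ae_ne_zero {m : ℕ} (hm : 0 < m) : ∀ᵐ w ∂(stdGauss m), w ≠ 0 := by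
  have : Nonempty (Fin m) := ⟨⟨0, hm⟩⟩
  rw [stdGauss_eq_withDensity]
  exact (withDensity_absolutelyContinuous _ _).ae_le (Measure.ae_ne volume 0)

lemma chiSq_ae_pos {m : ℕ} (hm : 0 < m) : ∀ᵐ t ∂(chiSq m), 0 < t := by
  rw [chiSq, ae_map_iff measurable_normSq.aemeasurable measurableSet_Ioi]
  exact (stdGauss_ae_ne_zero hm).mono fun w hw => normSq_pos hw

lemma integral_chiSq_exp_mul {m : ℕ} {c : ℝ} (hc : 0 < c) {g : ℝ → ℝ} (hg : Measurable g) :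
    ∫ t, exp (-((c ^ 2 - 1) * t / 2)) * g t ∂(chiSq m) =
      c⁻¹ ^ m * ∫ t, g (t / c ^ 2) ∂(chiSq m) := by
  rw [integral_chiSq (by fun_prop), integral_chiSq (by fun_prop), integral_stdGauss,
    integral_stdGauss]
  have h := Measure.integral_comp_smul (volume : Measure (Fin m → ℝ))
    (fun w => stdGaussPDF m (normSq w) * g (normSq w / c ^ 2)) c
  rw [Module.finrank_fin_fun, abs_of_pos (by positivity), smul_eq_mul, ← inv_pow] at h
  rw [← h]
  refine integral_congr_ae (ae_of_all _ fun w => ?_)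
  simp only [normSq_smul, stdGaussPDF]
  rw [mul_div_cancel_left₀ _ (by positivity), ← mul_assoc, mul_assoc _ (exp _) (exp _), ← exp_add]
  congr 4
  ring

lemma integrable_exp_mul_sq_gaussianReal {c : ℝ} (hc : c < 1) :
    Integrable (fun x => exp (c * x ^ 2 / 2)) (gaussianReal 0 1) := by
  rw [gaussianReal_of_var_ne_zero 0 one_ne_zero,
    integrable_withDensity_iff_integrable_smul' (measurable_gaussianPDF 0 1)
      (ae_of_all _ fun _ => gaussianPDF_lt_top)]
  have := (integrable_exp_neg_mul_sq (b := (1 - c) / 2) (by linarith)).const_mul (√(2 * π))⁻¹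
  refine this.congr (ae_of_all _ fun x => ?_)
  simp only [toReal_gaussianPDF, gaussianPDFReal, smul_eq_mul, NNReal.coe_one, mul_one, sub_zero]
  rw [mul_assoc, ← exp_add]
  congr 2
  ring

lemma integral_exp_mul_sq_gaussianReal {c : ℝ} (hc : c < 1) :
    ∫ x, exp (c * x ^ 2 / 2) ∂(gaussianReal 0 1) = (√(1 - c))⁻¹ := by
  rw [integral_gaussianReal_eq_integral_smul one_ne_zero]
  have h := integral_gaussian ((1 - c) / 2)
  calc _ = ∫ x : ℝ, (√(2 * π))⁻¹ * exp (-((1 - c) / 2) * x ^ 2) := by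
        refine integral_congr_ae (ae_of_all _ fun x => ?_)
        simp only [gaussianPDFReal, smul_eq_mul, NNReal.coe_one, mul_one, sub_zero]
        rw [mul_assoc, ← exp_add]
        congr 2
        ring
    _ = _ := by
        have h1 : 0 < 1 - c := by linarith
        rw [integral_const_mul, h, show π / ((1 - c) / 2) = (2 * π) / (1 - c) by field_simp,
          sqrt_div (by positivity)]
        have : √(2 * π) ≠ 0 := by positivity
        field_simp

lemma exp_sum_mul_sq {m : ℕ} (c w : Fin m → ℝ) :
    exp ((∑ k, c k * w k ^ 2) / 2) = ∏ k, exp (c k * w k ^ 2 / 2) := by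
  rw [← exp_sum, Finset.sum_div]

lemma integrable_exp_quadratic {m : ℕ} {c : Fin m → ℝ} (hc : ∀ k, c k < 1) :
    Integrable (fun w => exp ((∑ k, c k * w k ^ 2) / 2)) (stdGauss m) := by
  simp_rw [exp_sum_mul_sq]
  exact Integrable.fintype_prod_dep fun k => integrable_exp_mul_sq_gaussianReal (hc k)

lemma integral_exp_quadratic {m : ℕ} {c : Fin m → ℝ} (hc : ∀ k, c k < 1) :
    ∫ w, exp ((∑ k, c k * w k ^ 2) / 2) ∂(stdGauss m) = ∏ k, (√(1 - c k))⁻¹ := by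
  simp_rw [exp_sum_mul_sq]
  rw [stdGauss, integral_fintype_prod_eq_prod (fun k x => exp (c k * x ^ 2 / 2))]
  exact Finset.prod_congr rfl fun k _ => integral_exp_mul_sq_gaussianReal (hc k)

lemma integrable_exp_chiSq (m : ℕ) {t : ℝ} (ht : t < 1) :
    Integrable (fun R => exp (t * R / 2)) (chiSq m) := by
  rw [integrable_chiSq_iff (by fun_prop)]
  simpa [normSq, Finset.mul_sum] using integrable_exp_quadratic (m := m) (c := fun _ => t)
    fun _ => ht

lemma integral_exp_chiSq (m : ℕ) {t : ℝ} (ht : t < 1) :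
    ∫ R, exp (t * R / 2) ∂(chiSq m) = (√(1 - t))⁻¹ ^ m := by
  rw [integral_chiSq (by fun_prop)]
  simpa [normSq, Finset.mul_sum] using integral_exp_quadratic (m := m) (c := fun _ => t)
    fun _ => ht

lemma inv_sqrt_one_sub_pow_le (m : ℕ) {η : ℝ} (h : |η| ≤ 1 / 2) :
    (√(1 - η))⁻¹ ^ m ≤ exp (m * (η / 2 + η ^ 2)) := by
  obtain ⟨h1, h2⟩ := abs_le.1 h
  have hpos : 0 < 1 - η := by linarith
  rw [exp_nat_mul]
  refine pow_le_pow_left₀ (by positivity) ?_ m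
  rw [← sqrt_inv, sqrt_le_left (exp_pos _).le, ← exp_nat_mul]
  calc (1 - η)⁻¹ ≤ (η + 2 * η ^ 2) + 1 := by
        rw [inv_le_iff_one_le_mul₀ hpos]
        nlinarith [sq_nonneg η]
    _ ≤ exp (η + 2 * η ^ 2) := add_one_le_exp _
    _ = _ := by congr 1; push_cast; ring

lemma integral_sq_gaussianReal : ∫ x, x ^ 2 ∂(gaussianReal 0 1) = 1 := by
  have h := variance_fun_id_gaussianReal (μ := 0) (v := 1)
  rw [variance_eq_integral (by fun_prop), integral_id_gaussianReal] at h
  simpa using h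

lemma integrable_sq_gaussianReal : Integrable (fun x => x ^ 2) (gaussianReal 0 1) :=
  ((memLp_id_gaussianReal' 2 (by simp)).integrable_sq)

lemma integrable_sq_stdGauss {m : ℕ} (k : Fin m) :
    Integrable (fun w => w k ^ 2) (stdGauss m) :=
  integrable_comp_eval (μ := fun _ : Fin m => gaussianReal 0 1) (i := k)
    integrable_sq_gaussianReal

lemma integral_quadratic {m : ℕ} (c : Fin m → ℝ) :
    ∫ w, ∑ k, c k * w k ^ 2 ∂(stdGauss m) = ∑ k, c k := by
  rw [integral_finsetSum _ fun k _ => (integrable_sq_stdGauss k).const_mul _]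
  refine Finset.sum_congr rfl fun k _ => ?_
  rw [integral_const_mul]
  have h := integral_comp_eval (μ := fun _ : Fin m => gaussianReal 0 1) (i := k)
    (f := fun x => x ^ 2) integrable_sq_gaussianReal.aestronglyMeasurable
  rw [stdGauss, h, integral_sq_gaussianReal, mul_one]

lemma integrable_id_chiSq (m : ℕ) : Integrable (fun R => R) (chiSq m) := by
  rw [integrable_chiSq_iff (f := fun R => R) measurable_id]
  exact integrable_finsetSum _ fun k _ => integrable_sq_stdGauss k

lemma integral_id_chiSq (m : ℕ) : ∫ R, R ∂(chiSq m) = m := by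
  rw [integral_chiSq (f := fun R => R) measurable_id]
  simpa [normSq] using integral_quadratic (fun _ : Fin m => 1)

lemma integrable_exp_centered_chiSq (m : ℕ) {η : ℝ} (hη : |η| ≤ 1 / 2) :
    Integrable (fun R => exp (η * (R - m) / 2)) (chiSq m) := by
  refine ((integrable_exp_chiSq m (t := η) (by linarith [abs_le.1 hη])).const_mul
    (exp (-(η * m / 2)))).congr (ae_of_all _ fun R => ?_)
  simp only [← exp_add]
  congr 1
  ring

lemma integral_exp_centered_chiSq_le (m : ℕ) {η : ℝ} (hη : |η| ≤ 1 / 2) :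
    ∫ R, exp (η * (R - m) / 2) ∂(chiSq m) ≤ exp (m * η ^ 2) := by
  calc _ = exp (-(η * m / 2)) * ∫ R, exp (η * R / 2) ∂(chiSq m) := by
        rw [← integral_const_mul]
        refine integral_congr_ae (ae_of_all _ fun R => ?_)
        simp only [← exp_add]
        congr 1
        ring
    _ ≤ exp (-(η * m / 2)) * exp (m * (η / 2 + η ^ 2)) := by
        rw [integral_exp_chiSq m (by linarith [abs_le.1 hη])]
        gcongr
        exact inv_sqrt_one_sub_pow_le m hη
    _ = _ := by
        rw [← exp_add]
        congr 1
        ring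

lemma sq_le_exp_of_nonneg {u : ℝ} (h : 0 ≤ u) : u ^ 2 ≤ exp u := by
  have h1 := quadratic_le_exp_of_nonneg (x := u / 2) (by linarith)
  have h2 : exp u = exp (u / 2) ^ 2 := by rw [← exp_nat_mul]; congr 1; push_cast; ring
  rw [h2]
  refine pow_le_pow_left₀ h ?_ 2
  nlinarith [sq_nonneg (u / 2 - 1)]

lemma sq_le_exp_add_exp_neg (u : ℝ) : u ^ 2 ≤ exp u + exp (-u) := by
  rcases le_total 0 u with h | h
  · linarith [sq_le_exp_of_nonneg h, exp_pos (-u)]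
  · have := sq_le_exp_of_nonneg (u := -u) (by linarith)
    rw [neg_sq] at this
    linarith [exp_pos u]

lemma sq_centered_chiSq_le {m : ℕ} (hm : 0 < m) (R : ℝ) :
    (R - m) ^ 2 ≤ 16 * m * (exp ((2 * √m)⁻¹ * (R - m) / 2) + exp (-(2 * √m)⁻¹ * (R - m) / 2)) := by
  have hm' : (0 : ℝ) < m := by exact_mod_cast hm
  have h := sq_le_exp_add_exp_neg ((2 * √m)⁻¹ * (R - m) / 2)
  have h2 : ((2 * √m)⁻¹ * (R - m) / 2) ^ 2 * (16 * m) = (R - m) ^ 2 := by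
    have : √(m : ℝ) ≠ 0 := by positivity
    field_simp
    rw [sq_sqrt hm'.le]
    ring
  rw [← h2, mul_comm]
  gcongr
  have h3 : -(2 * √(m : ℝ))⁻¹ * (R - m) / 2 = -((2 * √(m : ℝ))⁻¹ * (R - m) / 2) := by ring
  rwa [h3]

lemma abs_inv_two_sqrt_le {m : ℕ} (hm : 0 < m) : |(2 * √(m : ℝ))⁻¹| ≤ 1 / 2 := by
  have : 1 ≤ √(m : ℝ) := one_le_sqrt.2 (by exact_mod_cast hm)
  rw [abs_of_pos (by positivity), inv_le_comm₀ (by positivity) (by norm_num)]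
  linarith

lemma integrable_sq_centered_chiSq {m : ℕ} (hm : 0 < m) :
    Integrable (fun R : ℝ => (R - m) ^ 2) (chiSq m) := by
  have h1 := integrable_exp_centered_chiSq m (abs_inv_two_sqrt_le hm)
  have h2 := integrable_exp_centered_chiSq m (η := -(2 * √(m : ℝ))⁻¹)
    (by rw [abs_neg]; exact abs_inv_two_sqrt_le hm)
  refine ((h1.add h2).const_mul (16 * (m : ℝ))).mono'
    (by fun_prop : Measurable fun R : ℝ => (R - m) ^ 2).aestronglyMeasurable
    (ae_of_all _ fun R => ?_)
  rw [Real.norm_of_nonneg (sq_nonneg _)]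
  exact sq_centered_chiSq_le hm R

lemma integral_sq_centered_chiSq_le {m : ℕ} (hm : 0 < m) :
    ∫ R, (R - m) ^ 2 ∂(chiSq m) ≤ 64 * m := by
  have hm' : (0 : ℝ) < m := by exact_mod_cast hm
  have hη := abs_inv_two_sqrt_le hm
  have hη' : |-(2 * √(m : ℝ))⁻¹| ≤ 1 / 2 := by rwa [abs_neg]
  have h1 := integrable_exp_centered_chiSq m hη
  have h2 := integrable_exp_centered_chiSq m hη'
  have he : m * ((2 * √(m : ℝ))⁻¹) ^ 2 = 1 / 4 := by
    rw [inv_pow, mul_pow, sq_sqrt hm'.le]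
    field_simp
    norm_num
  have hexp : exp (1 / 4) ≤ 2 := by
    have := exp_bound_div_one_sub_of_interval (x := 1 / 4) (by norm_num) (by norm_num)
    linarith
  calc _ ≤ ∫ R, 16 * m * (exp ((2 * √m)⁻¹ * (R - m) / 2) +
            exp (-(2 * √m)⁻¹ * (R - m) / 2)) ∂(chiSq m) :=
        integral_mono (integrable_sq_centered_chiSq hm) ((h1.add h2).const_mul _)
          (sq_centered_chiSq_le hm)
    _ ≤ 16 * m * (exp (1 / 4) + exp (1 / 4)) := by
        rw [integral_const_mul, integral_add h1 h2]
        gcongr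
        · rw [← he]; exact integral_exp_centered_chiSq_le m hη
        · rw [← he, ← neg_sq]; exact integral_exp_centered_chiSq_le m hη'
    _ ≤ _ := by nlinarith

/-- The Rayleigh quotient of the diagonal quadratic form with coefficients `ev`. -/
def rayleigh {m : ℕ} (ev w : Fin m → ℝ) : ℝ := (∑ k, ev k * w k ^ 2) / normSq w

lemma measurable_rayleigh {m : ℕ} (ev : Fin m → ℝ) : Measurable (rayleigh ev) := by
  have := measurable_normSq (m := m)
  unfold rayleigh
  fun_prop

lemma rayleigh_smul {m : ℕ} (ev : Fin m → ℝ) {c : ℝ} (hc : 0 < c) (w : Fin m → ℝ) :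
    rayleigh ev (c • w) = rayleigh ev w := by
  have h : ∑ k, ev k * (c • w) k ^ 2 = c ^ 2 * ∑ k, ev k * w k ^ 2 := by
    simp only [Pi.smul_apply, smul_eq_mul, Finset.mul_sum]
    exact Finset.sum_congr rfl fun k _ => by ring
  rw [rayleigh, rayleigh, h, normSq_smul, mul_div_mul_left _ _ (by positivity)]

lemma rayleigh_mul_normSq {m : ℕ} (ev w : Fin m → ℝ) :
    rayleigh ev w * normSq w = ∑ k, ev k * w k ^ 2 := by
  rcases eq_or_ne w 0 with rfl | hw
  · simp [normSq]
  · exact div_mul_cancel₀ _ (normSq_pos hw).ne'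

lemma abs_rayleigh_le {m : ℕ} {ev : Fin m → ℝ} {C : ℝ} (hC : 0 ≤ C) (hev : ∀ k, |ev k| ≤ C)
    (w : Fin m → ℝ) : |rayleigh ev w| ≤ C := by
  rw [rayleigh, abs_div, abs_of_nonneg (normSq_nonneg w)]
  refine div_le_of_le_mul₀ (normSq_nonneg w) hC ?_
  rw [normSq, Finset.mul_sum]
  refine (Finset.abs_sum_le_sum_abs _ _).trans (Finset.sum_le_sum fun k _ => ?_)
  rw [abs_mul, abs_of_nonneg (sq_nonneg (w k))]
  gcongr
  exact hev k

/-- The law of the Rayleigh quotient of a standard Gaussian vector. -/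
def rayLaw {m : ℕ} (ev : Fin m → ℝ) : Measure ℝ := (stdGauss m).map (rayleigh ev)

instance {m : ℕ} (ev : Fin m → ℝ) : IsProbabilityMeasure (rayLaw ev) :=
  Measure.isProbabilityMeasure_map (measurable_rayleigh ev).aemeasurable

lemma rayLaw_ae_abs_le {m : ℕ} {ev : Fin m → ℝ} {C : ℝ} (hC : 0 ≤ C) (hev : ∀ k, |ev k| ≤ C) :
    ∀ᵐ l ∂(rayLaw ev), |l| ≤ C := by
  rw [rayLaw, ae_map_iff (measurable_rayleigh ev).aemeasurable
    (measurableSet_le (by fun_prop) (by fun_prop))]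
  exact ae_of_all _ fun w => abs_rayleigh_le hC hev w

lemma map_rayleigh_normSq {m : ℕ} (hm : 0 < m) (ev : Fin m → ℝ) :
    (stdGauss m).map (fun w => (rayleigh ev w, normSq w)) = (rayLaw ev).prod (chiSq m) :=
  (indepFun_iff_map_prod_eq_prod_map_map (measurable_rayleigh ev).aemeasurable
    measurable_normSq.aemeasurable).1
      (indepFun_normSq hm (measurable_rayleigh ev) fun _ hc w => rayleigh_smul ev hc w)

lemma measurable_rayleigh_normSq {m : ℕ} (ev : Fin m → ℝ) :
    Measurable fun w : Fin m → ℝ => (rayleigh ev w, normSq w) :=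
  (measurable_rayleigh ev).prodMk measurable_normSq

lemma integral_rayleigh_normSq {m : ℕ} (hm : 0 < m) (ev : Fin m → ℝ) {f : ℝ × ℝ → ℝ}
    (hf : Measurable f) :
    ∫ w, f (rayleigh ev w, normSq w) ∂(stdGauss m) = ∫ p, f p ∂((rayLaw ev).prod (chiSq m)) := by
  rw [← map_rayleigh_normSq hm, integral_map (measurable_rayleigh_normSq ev).aemeasurable
    hf.aestronglyMeasurable]

lemma integrable_rayleigh_normSq {m : ℕ} (hm : 0 < m) (ev : Fin m → ℝ) {f : ℝ × ℝ → ℝ}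
    (hf : Measurable f) :
    Integrable (fun w => f (rayleigh ev w, normSq w)) (stdGauss m) ↔
      Integrable f ((rayLaw ev).prod (chiSq m)) := by
  rw [← map_rayleigh_normSq hm, integrable_map_measure hf.aestronglyMeasurable
    (measurable_rayleigh_normSq ev).aemeasurable]
  rfl

lemma integrable_id_rayLaw {m : ℕ} (ev : Fin m → ℝ) : Integrable (fun l => l) (rayLaw ev) := by
  have hev : ∀ k, |ev k| ≤ ∑ i, |ev i| := fun k =>
    Finset.single_le_sum (f := fun i => |ev i|) (fun _ _ => abs_nonneg _) (Finset.mem_univ k)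
  exact Integrable.of_bound (by fun_prop) _
    (rayLaw_ae_abs_le (Finset.sum_nonneg fun _ _ => abs_nonneg _) hev)

lemma integral_id_rayLaw {m : ℕ} (hm : 0 < m) {ev : Fin m → ℝ} (h0 : ∑ k, ev k = 0) :
    ∫ l, l ∂(rayLaw ev) = 0 := by
  have h1 := integral_rayleigh_normSq hm ev (f := fun p => p.1 * p.2) (by fun_prop)
  simp only [rayleigh_mul_normSq] at h1
  rw [integral_quadratic, h0, integral_prod_mul (fun l => l) (fun R => R), integral_id_chiSq] at h1
  have : (m : ℝ) ≠ 0 := by positivity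
  exact (mul_eq_zero.1 h1.symm).resolve_right this

/-- The moment generating function of the Rayleigh quotient. -/
def rayMGF {m : ℕ} (ev : Fin m → ℝ) (T : ℝ) : ℝ := ∫ l, exp (T * l) ∂(rayLaw ev)

lemma integrable_exp_rayLaw {m : ℕ} (ev : Fin m → ℝ) (T : ℝ) :
    Integrable (fun l => exp (T * l)) (rayLaw ev) := by
  have hev : ∀ k, |ev k| ≤ ∑ i, |ev i| := fun k =>
    Finset.single_le_sum (f := fun i => |ev i|) (fun _ _ => abs_nonneg _) (Finset.mem_univ k)
  refine Integrable.of_bound (C := exp (|T| * ∑ i, |ev i|)) (by fun_prop) ?_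
  filter_upwards [rayLaw_ae_abs_le (Finset.sum_nonneg fun _ _ => abs_nonneg _) hev] with l hl
  rw [Real.norm_of_nonneg (exp_pos _).le, exp_le_exp]
  calc T * l ≤ |T * l| := le_abs_self _
    _ = |T| * |l| := abs_mul _ _
    _ ≤ _ := by gcongr

lemma rayMGF_nonneg {m : ℕ} (ev : Fin m → ℝ) (T : ℝ) : 0 ≤ rayMGF ev T :=
  integral_nonneg fun _ => (exp_pos _).le

lemma one_le_rayMGF {m : ℕ} (hm : 0 < m) {ev : Fin m → ℝ} (h0 : ∑ k, ev k = 0) (T : ℝ) :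
    1 ≤ rayMGF ev T := by
  have hi : Integrable (fun l => T * l + 1) (rayLaw ev) :=
    ((integrable_id_rayLaw ev).const_mul T).add (integrable_const 1)
  calc (1 : ℝ) = ∫ l, (T * l + 1) ∂(rayLaw ev) := by
        rw [integral_add ((integrable_id_rayLaw ev).const_mul T) (integrable_const 1),
          integral_const_mul, integral_id_rayLaw hm h0]
        simp
    _ ≤ _ := integral_mono hi (integrable_exp_rayLaw ev T) fun l => add_one_le_exp _

lemma rayMGF_mono {m : ℕ} (hm : 0 < m) {ev : Fin m → ℝ} (h0 : ∑ k, ev k = 0) {T T' : ℝ}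
    (hT : 0 ≤ T) (h : T ≤ T') : rayMGF ev T ≤ rayMGF ev T' := by
  rcases hT.eq_or_lt with rfl | hT
  · calc rayMGF ev 0 = 1 := by simp [rayMGF]
      _ ≤ _ := one_le_rayMGF hm h0 T'
  have hT' : 0 < T' := hT.trans_le h
  set θ := T / T'
  have hθ1 : θ ≤ 1 := (div_le_one hT').2 h
  have hθ0 : 0 ≤ θ := by positivity
  have hi := (integrable_exp_rayLaw ev T').const_mul θ
  have hle : rayMGF ev T ≤ (1 - θ) + θ * rayMGF ev T' := by
    calc rayMGF ev T ≤ ∫ l, ((1 - θ) + θ * exp (T' * l)) ∂(rayLaw ev) := by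
          refine integral_mono (integrable_exp_rayLaw ev T)
            ((integrable_const _).add hi) fun l => ?_
          have := convexOn_exp.2 (Set.mem_univ 0) (Set.mem_univ (T' * l)) (sub_nonneg.2 hθ1) hθ0
            (by ring)
          simp only [smul_eq_mul, mul_zero, zero_add, exp_zero, mul_one] at this
          rwa [← mul_assoc, div_mul_cancel₀ _ hT'.ne'] at this
      _ = _ := by
          rw [integral_add (integrable_const _) hi, integral_const_mul]
          simp [rayMGF]
  nlinarith [one_le_rayMGF hm h0 T']

/-- The moment generating function of half the quadratic form `∑ ev k * w k ^ 2` under the standard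
Gaussian measure. -/
def quadMGF {m : ℕ} (ev : Fin m → ℝ) (a : ℝ) : ℝ := ∏ k, (√(1 - a * ev k))⁻¹

lemma quadMGF_pos {m : ℕ} {ev : Fin m → ℝ} {a : ℝ} (ha : ∀ k, a * ev k < 1) :
    0 < quadMGF ev a :=
  Finset.prod_pos fun k _ => inv_pos.2 (sqrt_pos.2 (by linarith [ha k]))

lemma exp_rayleigh_normSq {m : ℕ} (ev : Fin m → ℝ) (a : ℝ) (w : Fin m → ℝ) :
    exp (a * normSq w / 2 * rayleigh ev w) = exp ((∑ k, a * ev k * w k ^ 2) / 2) := by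
  congr 1
  have := rayleigh_mul_normSq ev w
  rw [show ∑ k, a * ev k * w k ^ 2 = a * ∑ k, ev k * w k ^ 2 by
    rw [Finset.mul_sum]; exact Finset.sum_congr rfl fun k _ => by ring, ← this]
  ring

lemma integrable_exp_prod {m : ℕ} (hm : 0 < m) {ev : Fin m → ℝ} {a : ℝ}
    (ha : ∀ k, a * ev k < 1) :
    Integrable (fun p : ℝ × ℝ => exp (a * p.2 / 2 * p.1)) ((rayLaw ev).prod (chiSq m)) := by
  rw [← integrable_rayleigh_normSq hm ev (by fun_prop)]
  simp only [exp_rayleigh_normSq]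
  exact integrable_exp_quadratic ha

lemma integral_exp_prod {m : ℕ} (hm : 0 < m) {ev : Fin m → ℝ} {a : ℝ}
    (ha : ∀ k, a * ev k < 1) :
    ∫ p : ℝ × ℝ, exp (a * p.2 / 2 * p.1) ∂((rayLaw ev).prod (chiSq m)) = quadMGF ev a := by
  rw [← integral_rayleigh_normSq hm ev (f := fun p => exp (a * p.2 / 2 * p.1)) (by fun_prop)]
  simp only [exp_rayleigh_normSq]
  exact integral_exp_quadratic ha

lemma integrable_rayMGF_chiSq {m : ℕ} (hm : 0 < m) {ev : Fin m → ℝ} {a : ℝ}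
    (ha : ∀ k, a * ev k < 1) : Integrable (fun R => rayMGF ev (a * R / 2)) (chiSq m) :=
  (integrable_exp_prod hm ha).integral_prod_right

lemma integral_rayMGF_chiSq {m : ℕ} (hm : 0 < m) {ev : Fin m → ℝ} {a : ℝ}
    (ha : ∀ k, a * ev k < 1) : ∫ R, rayMGF ev (a * R / 2) ∂(chiSq m) = quadMGF ev a := by
  rw [← integral_exp_prod hm ha, integral_prod_symm _ (integrable_exp_prod hm ha)]
  rfl

lemma rayMGF_le_quadMGF {m : ℕ} (hm : 0 < m) {ev : Fin m → ℝ} {b : ℝ}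
    (hb : ∀ k, b * ev k < 1) : rayMGF ev (b * m / 2) ≤ quadMGF ev b := by
  have hi := integrable_exp_prod hm hb
  rw [← integral_exp_prod hm hb, integral_prod _ hi]
  refine integral_mono_ae (integrable_exp_rayLaw ev _) hi.integral_prod_left ?_
  filter_upwards [hi.prod_right_ae] with l hl
  have hR := integrable_id_chiSq m
  set e := exp (b * m / 2 * l)
  have h1 : Integrable (fun R : ℝ => e * (b * l / 2) * (R - m)) (chiSq m) :=
    (hR.sub (integrable_const _)).const_mul _
  calc e = ∫ R, (e * (b * l / 2) * (R - m) + e) ∂(chiSq m) := by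
        rw [integral_add h1 (integrable_const _), integral_const_mul,
          integral_sub hR (integrable_const _), integral_id_chiSq]
        simp
    _ ≤ _ := by
        refine integral_mono (h1.add (integrable_const _)) hl fun R => ?_
        have h2 : exp (b * R / 2 * l) = e * exp (b * l / 2 * (R - m)) := by
          rw [← exp_add]; congr 1; ring
        have h3 := add_one_le_exp (b * l / 2 * (R - m))
        have := mul_le_mul_of_nonneg_left h3 (exp_pos (b * m / 2 * l)).le
        simp only [h2]
        linarith

lemma mul_lt_one_of_le {x a b : ℝ} (ha : 0 ≤ a) (hab : a ≤ b) (h : b * x < 1) : a * x < 1 := by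
  rcases le_total x 0 with hx | hx
  · nlinarith
  · nlinarith

lemma quadMGF_mono {m : ℕ} (hm : 0 < m) {ev : Fin m → ℝ} (h0 : ∑ k, ev k = 0) {a b : ℝ}
    (ha : 0 ≤ a) (hab : a ≤ b) (hb : ∀ k, b * ev k < 1) : quadMGF ev a ≤ quadMGF ev b := by
  have ha' := fun k => mul_lt_one_of_le ha hab (hb k)
  rw [← integral_rayMGF_chiSq hm ha', ← integral_rayMGF_chiSq hm hb]
  refine integral_mono_ae (integrable_rayMGF_chiSq hm ha') (integrable_rayMGF_chiSq hm hb) ?_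
  filter_upwards [chiSq_ae_pos hm] with R hR
  exact rayMGF_mono hm h0 (by positivity) (by gcongr)

lemma quadMGF_le_mul_exp {m : ℕ} {ev : Fin m → ℝ} {a b : ℝ} (ha : 0 ≤ a) (hab : a ≤ b)
    (hb : ∀ k, b * ev k < 1) :
    quadMGF ev b ≤ quadMGF ev a * exp ((b - a) / 2 * ∑ k, ev k / (1 - b * ev k)) := by
  rw [Finset.mul_sum, exp_sum, quadMGF, quadMGF, ← Finset.prod_mul_distrib]
  refine Finset.prod_le_prod (fun k _ => by positivity) fun k _ => ?_
  have h1 : 0 < 1 - b * ev k := by linarith [hb k]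
  have h2 : 0 < 1 - a * ev k := by linarith [mul_lt_one_of_le ha hab (hb k)]
  have h3 : (1 - b * ev k)⁻¹ ≤ (1 - a * ev k)⁻¹ * exp ((b - a) * (ev k / (1 - b * ev k))) := by
    have := add_one_le_exp ((b - a) * (ev k / (1 - b * ev k)))
    rw [inv_mul_eq_div, le_div_iff₀ h2]
    refine le_trans (le_of_eq ?_) this
    field_simp
    ring
  have h4 : exp ((b - a) / 2 * (ev k / (1 - b * ev k))) =
      √(exp ((b - a) * (ev k / (1 - b * ev k)))) := by
    rw [← exp_half]; congr 1; ring
  rw [h4, ← sqrt_inv, ← sqrt_inv, ← sqrt_mul (by positivity)]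
  exact sqrt_le_sqrt h3

lemma measurable_rayMGF {m : ℕ} (ev : Fin m → ℝ) : Measurable (rayMGF ev) := by
  unfold rayMGF
  exact (StronglyMeasurable.integral_prod_right' (f := fun p : ℝ × ℝ => exp (p.1 * p.2))
    (by fun_prop : Measurable fun p : ℝ × ℝ => exp (p.1 * p.2)).stronglyMeasurable).measurable

lemma quadMGF_le_rayMGF_add {m : ℕ} (hm : 0 < m) {ev : Fin m → ℝ} (h0 : ∑ k, ev k = 0)
    {a η X : ℝ} (ha : 0 ≤ a) (hX : 0 ≤ X) (hη : 0 ≤ η) (hη1 : η < 1)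
    (hev : ∀ k, a / (1 - η) * ev k < 1) :
    quadMGF ev a ≤ rayMGF ev (a * X / 2) +
      exp (-(η * X / 2)) * ((√(1 - η))⁻¹ ^ m * quadMGF ev (a / (1 - η))) := by
  have hη' : 0 < 1 - η := by linarith
  have ha1 : a ≤ a / (1 - η) := by
    rw [le_div_iff₀ hη']; nlinarith
  have ha' := fun k => mul_lt_one_of_le ha ha1 (hev k)
  have hmeas : Measurable fun R : ℝ => rayMGF ev (a * R / 2) := by
    have := measurable_rayMGF ev
    fun_prop
  have hsc : ∫ R, exp (η * R / 2) * rayMGF ev (a * R / 2) ∂(chiSq m) =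
      (√(1 - η))⁻¹ ^ m * quadMGF ev (a / (1 - η)) := by
    have h := integral_chiSq_exp_mul (m := m) (sqrt_pos.2 hη') hmeas
    rw [sq_sqrt hη'.le] at h
    rw [← integral_rayMGF_chiSq hm hev]
    convert h using 5 <;> ring
  have hint : Integrable (fun R => exp (η * R / 2) * rayMGF ev (a * R / 2)) (chiSq m) := by
    refine Integrable.of_integral_ne_zero ?_
    rw [hsc]
    have := quadMGF_pos hev
    positivity
  rw [← hsc, ← integral_const_mul, ← integral_rayMGF_chiSq hm ha']
  calc _ ≤ ∫ R, (rayMGF ev (a * X / 2) +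
        exp (-(η * X / 2)) * (exp (η * R / 2) * rayMGF ev (a * R / 2))) ∂(chiSq m) := by
        refine integral_mono_ae (integrable_rayMGF_chiSq hm ha')
          ((integrable_const _).add (hint.const_mul _)) ?_
        filter_upwards [chiSq_ae_pos hm] with R hR
        have h1 := rayMGF_nonneg ev (a * R / 2)
        rw [← mul_assoc, ← exp_add]
        rcases le_total R X with h | h
        · have := rayMGF_mono hm h0 (T := a * R / 2) (T' := a * X / 2) (by positivity)
            (by gcongr)
          have : 0 ≤ exp (-(η * X / 2) + η * R / 2) * rayMGF ev (a * R / 2) := by positivity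
          linarith
        · have : 1 ≤ exp (-(η * X / 2) + η * R / 2) := one_le_exp (by nlinarith)
          nlinarith [rayMGF_nonneg ev (a * X / 2)]
    _ = _ := by
        rw [integral_add (integrable_const _) (hint.const_mul _)]
        simp

/-- The moment generating function of the Rayleigh quotient is stable under a small relative
decrease of its argument. -/
lemma rayMGF_ratio {m : ℕ} (hm : 0 < m) {ev : Fin m → ℝ} (h0 : ∑ k, ev k = 0)
    {a b η X D : ℝ} (ha : 0 ≤ a) (hX : 0 ≤ X) (hη : 0 ≤ η) (hη1 : η < 1) (hab : a / (1 - η) ≤ b)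
    (hb : ∀ k, b * ev k < 1) (hD : ∑ k, ev k / (1 - b * ev k) ≤ D) :
    (exp (-((b - a) / 2 * D)) - exp (-(η * X / 2)) * (√(1 - η))⁻¹ ^ m) * rayMGF ev (b * m / 2) ≤
      rayMGF ev (a * X / 2) := by
  have hη' : 0 < 1 - η := by linarith
  have ha1 : a ≤ a / (1 - η) := by
    rw [le_div_iff₀ hη']; nlinarith
  have hd0 : 0 ≤ a / (1 - η) := by positivity
  have hev := fun k => mul_lt_one_of_le hd0 hab (hb k)
  have hGb := quadMGF_pos hb
  have hF := rayMGF_le_quadMGF hm hb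
  have hF0 := rayMGF_nonneg ev (b * m / 2)
  have h1 := quadMGF_le_rayMGF_add hm h0 ha hX hη hη1 hev
  have h2 := quadMGF_mono hm h0 hd0 hab hb
  have h3 := quadMGF_le_mul_exp ha (ha1.trans hab) hb
  set E := exp (-(η * X / 2)) * (√(1 - η))⁻¹ ^ m with hE
  have hE0 : 0 ≤ E := by positivity
  have h4 : exp (-((b - a) / 2 * D)) * quadMGF ev b ≤ quadMGF ev a := by
    rw [exp_neg, inv_mul_le_iff₀ (exp_pos _), mul_comm]
    refine h3.trans ?_
    have hGa := quadMGF_pos fun k => mul_lt_one_of_le ha (ha1.trans hab) (hb k)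
    gcongr
    linarith
  have h5 : (exp (-((b - a) / 2 * D)) - E) * quadMGF ev b ≤ rayMGF ev (a * X / 2) := by
    have : E * quadMGF ev (a / (1 - η)) ≤ E * quadMGF ev b := by gcongr
    rw [← mul_assoc, ← hE] at h1
    linarith
  rcases le_total 0 (exp (-((b - a) / 2 * D)) - E) with h | h
  · exact (mul_le_mul_of_nonneg_left hF h).trans h5
  · exact (mul_nonpos_of_nonpos_of_nonneg h hF0).trans (rayMGF_nonneg _ _)

lemma sum_exp_two_pi (n : ℕ) (hn : 0 < n) (p : ℤ) :
    ∑ i ∈ Finset.range n, Complex.exp (2 * π * Complex.I * p / n) ^ i =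
      if (n : ℤ) ∣ p then (n : ℂ) else 0 := by
  have hn' : (n : ℂ) ≠ 0 := by exact_mod_cast hn.ne'
  have hpi : (2 * π * Complex.I : ℂ) ≠ 0 := Complex.two_pi_I_ne_zero
  set z := Complex.exp (2 * π * Complex.I * p / n) with hz
  split_ifs with h
  · obtain ⟨q, rfl⟩ := h
    have : z = 1 := by
      rw [hz, Complex.exp_eq_one_iff]
      refine ⟨q, ?_⟩
      push_cast
      field_simp
    simp [this]
  · have hz1 : z ≠ 1 := by
      intro hz1
      rw [hz, Complex.exp_eq_one_iff] at hz1
      obtain ⟨q, hq⟩ := hz1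
      refine h ⟨q, ?_⟩
      field_simp at hq
      exact_mod_cast hq
    have hzn : z ^ n = 1 := by
      rw [hz, ← Complex.exp_nat_mul, Complex.exp_eq_one_iff]
      exact ⟨p, by field_simp⟩
    rw [geom_sum_eq hz1, hzn, sub_self, zero_div]

lemma exp_two_pi_pow (n : ℕ) (p : ℤ) (i : ℕ) :
    Complex.exp (2 * π * Complex.I * p / n) ^ i =
      (cos (2 * π * p * i / n) : ℝ) + (sin (2 * π * p * i / n) : ℝ) * Complex.I := by
  rw [← Complex.exp_nat_mul, Complex.ofReal_cos, Complex.ofReal_sin, ← Complex.exp_mul_I]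
  congr 1
  push_cast
  ring

lemma sum_cos_two_pi (n : ℕ) (hn : 0 < n) (p : ℤ) :
    ∑ i : Fin n, cos (2 * π * p * (i : ℕ) / n) = if (n : ℤ) ∣ p then (n : ℝ) else 0 := by
  have h := congr_arg Complex.re (sum_exp_two_pi n hn p)
  rw [Fin.sum_univ_eq_sum_range fun i => cos (2 * π * p * i / n)]
  simp only [exp_two_pi_pow, Complex.re_sum] at h
  split_ifs at h ⊢ <;> simpa [-Complex.ofReal_cos, -Complex.ofReal_sin] using h

lemma sum_sin_two_pi (n : ℕ) (hn : 0 < n) (p : ℤ) :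
    ∑ i : Fin n, sin (2 * π * p * (i : ℕ) / n) = 0 := by
  have h := congr_arg Complex.im (sum_exp_two_pi n hn p)
  rw [Fin.sum_univ_eq_sum_range fun i => sin (2 * π * p * i / n)]
  simp only [exp_two_pi_pow, Complex.im_sum] at h
  split_ifs at h <;> simpa [-Complex.ofReal_cos, -Complex.ofReal_sin] using h

/-- The angle `2πki/n`. -/
def dftAngle (n k i : ℕ) : ℝ := 2 * π * k * i / n

/-- The discrete Hartley basis of `ℝ^n`. -/
def hartley (n : ℕ) (k i : Fin n) : ℝ := (cos (dftAngle n k i) + sin (dftAngle n k i)) / √n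

lemma sum_hartley_mul {n : ℕ} (k l : Fin n) :
    ∑ i, hartley n k i * hartley n l i = if k = l then 1 else 0 := by
  have hn : 0 < n := k.pos
  have hn' : (n : ℝ) ≠ 0 := by positivity
  have h1 := sum_cos_two_pi n hn ((k : ℤ) - l)
  have h2 := sum_sin_two_pi n hn ((k : ℤ) + l)
  have hd : (n : ℤ) ∣ (k : ℤ) - l ↔ k = l := by
    constructor
    · intro h
      have := Int.eq_zero_of_abs_lt_dvd h (by rw [abs_lt]; constructor <;> omega)
      ext
      omega
    · rintro rfl
      simp
  have hterm : ∀ i : Fin n, hartley n k i * hartley n l i =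
      (cos (2 * π * ((k : ℤ) - l : ℤ) * (i : ℕ) / n) +
        sin (2 * π * ((k : ℤ) + l : ℤ) * (i : ℕ) / n)) / n := by
    intro i
    have e1 : 2 * π * ((k : ℤ) - l : ℤ) * (i : ℕ) / n = dftAngle n k i - dftAngle n l i := by
      push_cast [dftAngle]; ring
    have e2 : 2 * π * ((k : ℤ) + l : ℤ) * (i : ℕ) / n = dftAngle n k i + dftAngle n l i := by
      push_cast [dftAngle]; ring
    rw [e1, e2, cos_sub, sin_add, hartley, hartley, div_mul_div_comm,
      mul_self_sqrt (Nat.cast_nonneg n)]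
    ring
  simp_rw [hterm]
  rw [← Finset.sum_div, Finset.sum_add_distrib, h1, h2]
  simp only [hd]
  split_ifs <;> field_simp <;> simp

lemma dftAngle_add {n : ℕ} [NeZero n] (l : ℕ) (i j : Fin n) :
    ∃ q : ℤ, dftAngle n l (i + j : Fin n) = dftAngle n l i + dftAngle n l j + q * (2 * π) := by
  obtain ⟨d, hd⟩ : ∃ d : ℕ, d = ((i : ℕ) + j) / n := ⟨_, rfl⟩
  refine ⟨-(l * d : ℕ), ?_⟩
  have hn : (n : ℝ) ≠ 0 := NeZero.ne _
  have h : (((i + j : Fin n) : ℕ) : ℝ) = i + j - n * d := by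
    rw [Fin.val_add, eq_sub_iff_add_eq, hd]
    exact_mod_cast Nat.mod_add_div ((i : ℕ) + j) n
  rw [dftAngle, h, dftAngle, dftAngle]
  push_cast
  field_simp
  ring

lemma hartley_add_add_hartley_sub {n : ℕ} [NeZero n] (l i j : Fin n) :
    hartley n l (i + j) + hartley n l (i - j) = 2 * cos (dftAngle n l j) * hartley n l i := by
  obtain ⟨q, hq⟩ := dftAngle_add (l : ℕ) i j
  obtain ⟨q', hq'⟩ := dftAngle_add (l : ℕ) (i - j) j
  rw [sub_add_cancel] at hq'
  have hq'' : dftAngle n l (i - j : Fin n) =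
      dftAngle n l i - dftAngle n l j + (-q' : ℤ) * (2 * π) := by
    push_cast; linarith
  rw [hartley, hartley, hartley, hq, hq'', cos_add_int_mul_two_pi, sin_add_int_mul_two_pi,
    cos_add_int_mul_two_pi, sin_add_int_mul_two_pi, cos_add, sin_add, cos_sub, sin_sub]
  ring

/-- The vector with coordinates `y` in the Hartley basis. -/
def hartleyMap (n : ℕ) (y : Fin n → ℝ) (i : Fin n) : ℝ := ∑ k, y k * hartley n k i

lemma sum_hartleyMap_mul {n : ℕ} (y : Fin n → ℝ) (l : Fin n) :
    ∑ i, hartleyMap n y i * hartley n l i = y l := by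
  simp_rw [hartleyMap, Finset.sum_mul]
  rw [Finset.sum_comm]
  simp_rw [mul_assoc, ← Finset.mul_sum, sum_hartley_mul]
  simp

lemma sum_hartleyMap_mul_sum {n : ℕ} (y c : Fin n → ℝ) :
    ∑ i, hartleyMap n y i * ∑ k, c k * hartley n k i = ∑ k, c k * y k := by
  simp_rw [Finset.mul_sum]
  rw [Finset.sum_comm]
  refine Finset.sum_congr rfl fun k _ => ?_
  rw [← sum_hartleyMap_mul y k, Finset.mul_sum]
  exact Finset.sum_congr rfl fun i _ => by ring

lemma normSq_hartleyMap {n : ℕ} (y : Fin n → ℝ) : normSq (hartleyMap n y) = normSq y := by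
  have h := sum_hartleyMap_mul_sum y y
  simp only [normSq, pow_two]
  exact h

lemma sum_hartleyMap_shift {n : ℕ} [NeZero n] (y : Fin n → ℝ) (j : Fin n) :
    ∑ i, hartleyMap n y i * hartleyMap n y (i + j) =
      ∑ k : Fin n, cos (dftAngle n k j) * y k ^ 2 := by
  have h1 : ∑ i, hartleyMap n y i * hartleyMap n y (i + j) =
      ∑ i, hartleyMap n y i * hartleyMap n y (i - j) := by
    rw [← Equiv.sum_comp (Equiv.subRight j)]
    exact Finset.sum_congr rfl fun i _ => by simp [mul_comm]
  have h2 : ∀ i, hartleyMap n y (i + j) + hartleyMap n y (i - j) =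
      ∑ k : Fin n, 2 * cos (dftAngle n k j) * y k * hartley n k i := by
    intro i
    rw [hartleyMap, hartleyMap, ← Finset.sum_add_distrib]
    refine Finset.sum_congr rfl fun k _ => ?_
    rw [← mul_add, hartley_add_add_hartley_sub]
    ring
  have h3 := sum_hartleyMap_mul_sum y fun k : Fin n => 2 * cos (dftAngle n k j) * y k
  simp_rw [← h2, mul_add, Finset.sum_add_distrib, ← h1] at h3
  have h4 : ∑ k : Fin n, 2 * cos (dftAngle n k j) * y k * y k =
      2 * ∑ k : Fin n, cos (dftAngle n k j) * y k ^ 2 := by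
    rw [Finset.mul_sum]
    exact Finset.sum_congr rfl fun k _ => by ring
  linarith

/-- The eigenvalues of the interaction matrix. -/
def eigval (n r k : ℕ) : ℝ := (r : ℝ)⁻¹ * ∑ j ∈ Finset.Icc 1 r, cos (dftAngle n k j)

lemma neg_Ham_hartleyMap {n r : ℕ} (hn : r < n) (y : Fin n → ℝ) :
    -Ham n r (hartleyMap n y) = (∑ k : Fin n, eigval n r k * y k ^ 2) / 2 := by
  have : NeZero n := ⟨by omega⟩
  rw [Ham, Finset.sum_comm]
  have h : ∀ j ∈ Finset.Icc 1 r, ∑ i : Fin n, hartleyMap n y i *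
      hartleyMap n y ⟨((i : ℕ) + j) % n, Nat.mod_lt _ i.pos⟩ =
      ∑ k : Fin n, cos (dftAngle n k j) * y k ^ 2 := by
    intro j hj
    have hjn : j < n := by have := Finset.mem_Icc.1 hj; omega
    exact sum_hartleyMap_shift y ⟨j, hjn⟩
  rw [Finset.sum_congr rfl h, Finset.sum_comm]
  simp_rw [eigval, ← Finset.sum_mul, mul_assoc, ← Finset.mul_sum]
  rw [one_div, mul_inv]
  ring

lemma Mag_hartleyMap {m : ℕ} (y : Fin (m + 1) → ℝ) :
    Mag (m + 1) (hartleyMap (m + 1) y) = √(m + 1 : ℕ) * y 0 := by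
  rw [Mag, ← sum_hartleyMap_mul y 0, Finset.mul_sum]
  refine Finset.sum_congr rfl fun i _ => ?_
  have : √((m + 1 : ℕ) : ℝ) ≠ 0 := by positivity
  simp only [hartley, dftAngle, Fin.val_zero]
  field_simp
  simp

lemma measurePreserving_hartleyMap (n : ℕ) :
    MeasurePreserving (hartleyMap n) (stdGauss n) (stdGauss n) := by
  have hmeas : Measurable (hartleyMap n) := by
    refine measurable_pi_iff.2 fun i => ?_
    simp only [hartleyMap]
    fun_prop
  refine ⟨hmeas, ?_⟩
  set v : Fin n → EuclideanSpace ℝ (Fin n) := fun k => WithLp.toLp 2 (hartley n k)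
  have hv : Orthonormal ℝ v := by
    rw [orthonormal_iff_ite]
    intro k l
    rw [← sum_hartley_mul k l, PiLp.inner_apply]
    exact Finset.sum_congr rfl fun i _ => by simp [v, mul_comm]
  have hspan : ⊤ ≤ Submodule.span ℝ (Set.range v) := by
    rw [hv.linearIndependent.span_eq_top_of_card_eq_finrank' (by simp)]
  set b := OrthonormalBasis.mk hv hspan
  have h1 := stdGaussian_eq_map_pi_orthonormalBasis b
  have h2 := map_pi_eq_stdGaussian (ι := Fin n)
  rw [h1] at h2
  have h3 := congr_arg (Measure.map (fun w : EuclideanSpace ℝ (Fin n) => WithLp.ofLp w)) h2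
  rw [Measure.map_map (by fun_prop) (by fun_prop),
    Measure.map_map (by fun_prop) (by fun_prop)] at h3
  have h4 : (fun w : EuclideanSpace ℝ (Fin n) => WithLp.ofLp w) ∘
      (WithLp.toLp 2 : (Fin n → ℝ) → EuclideanSpace ℝ (Fin n)) = id := rfl
  rw [h4, Measure.map_id] at h3
  rw [stdGauss]
  refine Eq.trans ?_ h3.symm
  congr 1
  funext y i
  simp [hartleyMap, b, v]

lemma sum_cos_dftAngle {n : ℕ} (hn : 0 < n) (p : ℤ) :
    ∑ k : Fin n, cos (2 * π * k * p / n) = if (n : ℤ) ∣ p then (n : ℝ) else 0 := by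
  rw [← sum_cos_two_pi n hn p]
  exact Finset.sum_congr rfl fun k _ => by ring_nf

lemma eigval_zero {n r : ℕ} (hr : 0 < r) : eigval n r 0 = 1 := by
  have : (r : ℝ) ≠ 0 := by positivity
  simp [eigval, dftAngle, this]

lemma sum_eigval {n r : ℕ} (hn : r < n) : ∑ k : Fin n, eigval n r k = 0 := by
  simp_rw [eigval]
  rw [← Finset.mul_sum, Finset.sum_comm, Finset.sum_eq_zero, mul_zero]
  intro j hj
  obtain ⟨h1, h2⟩ := Finset.mem_Icc.1 hj
  have h := sum_cos_dftAngle (n := n) (by omega) j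
  rw [if_neg (by norm_cast; exact Nat.not_dvd_of_pos_of_lt h1 (by omega))] at h
  simpa [dftAngle] using h

lemma sum_eigval_sq {n r : ℕ} (hr : 0 < r) (hn : 2 * r < n) :
    ∑ k : Fin n, eigval n r k ^ 2 = n / (2 * r) := by
  have hr' : (r : ℝ) ≠ 0 := by positivity
  have h1 : ∀ k : Fin n, eigval n r k ^ 2 = (r : ℝ)⁻¹ ^ 2 * ∑ i ∈ Finset.Icc 1 r,
      ∑ j ∈ Finset.Icc 1 r, (cos (2 * π * k * ((i : ℤ) - j : ℤ) / n) +
        cos (2 * π * k * ((i : ℤ) + j : ℤ) / n)) / 2 := by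
    intro k
    rw [eigval, mul_pow, pow_two (∑ j ∈ _, _), Finset.sum_mul_sum]
    congr 1
    refine Finset.sum_congr rfl fun i _ => Finset.sum_congr rfl fun j _ => ?_
    have e1 : 2 * π * k * ((i : ℤ) - j : ℤ) / n = dftAngle n k i - dftAngle n k j := by
      push_cast [dftAngle]; ring
    have e2 : 2 * π * k * ((i : ℤ) + j : ℤ) / n = dftAngle n k i + dftAngle n k j := by
      push_cast [dftAngle]; ring
    rw [e1, e2, cos_add, cos_sub]
    ring
  simp_rw [h1]
  rw [← Finset.mul_sum, Finset.sum_comm]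
  have h2 : ∀ i ∈ Finset.Icc 1 r, ∑ k : Fin n, ∑ j ∈ Finset.Icc 1 r,
      (cos (2 * π * k * ((i : ℤ) - j : ℤ) / n) +
        cos (2 * π * k * ((i : ℤ) + j : ℤ) / n)) / 2 = n / 2 := by
    intro i hi
    obtain ⟨hi1, hi2⟩ := Finset.mem_Icc.1 hi
    rw [Finset.sum_comm, Finset.sum_eq_single_of_mem i hi]
    · rw [← Finset.sum_div, Finset.sum_add_distrib, sum_cos_dftAngle (by omega),
        sum_cos_dftAngle (by omega), if_pos (by simp), if_neg, add_zero]
      norm_cast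
      exact Nat.not_dvd_of_pos_of_lt (by omega) (by omega)
    · intro j hj hij
      obtain ⟨hj1, hj2⟩ := Finset.mem_Icc.1 hj
      rw [← Finset.sum_div, Finset.sum_add_distrib, sum_cos_dftAngle (by omega),
        sum_cos_dftAngle (by omega), if_neg, if_neg, add_zero, zero_div]
      · norm_cast
        exact Nat.not_dvd_of_pos_of_lt (by omega) (by omega)
      · intro h
        have := Int.eq_zero_of_abs_lt_dvd h (by rw [abs_lt]; constructor <;> omega)
        omega
  rw [Finset.sum_congr rfl h2]
  simp only [Finset.sum_const, Nat.card_Icc, add_tsub_cancel_right, nsmul_eq_mul]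
  field_simp

lemma abs_eigval_le (n r k : ℕ) : |eigval n r k| ≤ 1 := by
  rw [eigval, abs_mul, abs_of_nonneg (by positivity : (0 : ℝ) ≤ (r : ℝ)⁻¹)]
  refine (mul_le_mul_of_nonneg_left (Finset.abs_sum_le_sum_abs _ _) (by positivity)).trans ?_
  refine (mul_le_mul_of_nonneg_left (Finset.sum_le_sum fun j _ => abs_cos_le_one _)
    (by positivity)).trans ?_
  simp only [Finset.sum_const, Nat.card_Icc, add_tsub_cancel_right, nsmul_eq_mul, mul_one]
  exact inv_mul_le_one

lemma eigval_reflect {n r k : ℕ} (hk : k < n) : eigval n r (n - k) = eigval n r k := by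
  have hn : (n : ℝ) ≠ 0 := by have : 0 < n := by omega
                              positivity
  rw [eigval, eigval]
  congr 1
  refine Finset.sum_congr rfl fun j _ => ?_
  rw [dftAngle, Nat.cast_sub hk.le, ← cos_neg, dftAngle]
  have : -(2 * π * ((n : ℝ) - k) * j / n) = 2 * π * k * j / n + (-(j : ℤ) : ℤ) * (2 * π) := by
    push_cast
    field_simp
    ring
  rw [this, cos_add_int_mul_two_pi]

lemma two_sin_mul_sum_cos (α : ℝ) (r : ℕ) :
    2 * sin α * ∑ j ∈ Finset.Icc 1 r, cos (2 * j * α) = sin ((2 * r + 1) * α) - sin α := by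
  induction r with
  | zero => simp
  | succ r ih =>
    rw [Finset.sum_Icc_succ_top (by omega), mul_add, ih]
    have e1 : (2 * ((r + 1 : ℕ) : ℝ) + 1) * α = 2 * (r + 1 : ℕ) * α + α := by ring
    have e2 : (2 * (r : ℝ) + 1) * α = 2 * (r + 1 : ℕ) * α - α := by push_cast; ring
    rw [e1, e2, sin_add, sin_sub]
    ring

lemma cube_le_three_mul_sum_sq (r : ℕ) : (r : ℝ) ^ 3 ≤ 3 * ∑ j ∈ Finset.Icc 1 r, (j : ℝ) ^ 2 := by
  induction r with
  | zero => simp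
  | succ r ih =>
    rw [Finset.sum_Icc_succ_top (by omega), mul_add]
    push_cast
    nlinarith [(Nat.cast_nonneg r : (0 : ℝ) ≤ r)]

/-- A lower bound on the spectral gap at frequencies `k ≤ n / 2`. -/
lemma inv_one_sub_eigval_le_of_le_half {n r k : ℕ} (hr : 0 < r) (hk : 1 ≤ k) (hkn : 2 * k ≤ n) :
    0 < 1 - eigval n r k ∧
      (1 - eigval n r k)⁻¹ ≤ 2 + ((n : ℝ) / r) ^ 2 / 2 * ((k : ℝ) ^ 2)⁻¹ := by
  have hn0 : (0 : ℝ) < n := by have : 0 < n := by omega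
                               positivity
  have hr0 : (0 : ℝ) < r := by positivity
  have hk0 : (0 : ℝ) < k := by positivity
  have hkn' : 2 * (k : ℝ) ≤ n := by exact_mod_cast hkn
  set α := π * k / n with hα
  have hang : ∀ j : ℕ, dftAngle n k j = 2 * j * α := by
    intro j
    rw [dftAngle, hα]
    ring
  rcases le_or_gt (2 * ((r : ℝ) * k)) n with h | h
  · have h1 : 1 - eigval n r k = (r : ℝ)⁻¹ * ∑ j ∈ Finset.Icc 1 r, 2 * sin (j * α) ^ 2 := by
      have : (1 : ℝ) = (r : ℝ)⁻¹ * ∑ j ∈ Finset.Icc 1 r, 1 := by simp [hr0.ne']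
      rw [eigval]
      nth_rw 1 [this]
      rw [← mul_sub, ← Finset.sum_sub_distrib]
      congr 1
      refine Finset.sum_congr rfl fun j _ => ?_
      rw [hang, mul_assoc 2, cos_two_mul, cos_sq']
      ring
    have h2 : 8 / 3 * (r * k / n : ℝ) ^ 2 ≤ 1 - eigval n r k := by
      have h3 : ∀ j ∈ Finset.Icc 1 r, 8 * (k / n : ℝ) ^ 2 * (j : ℝ) ^ 2 ≤ 2 * sin (j * α) ^ 2 := by
        intro j hj
        have hjr : (j : ℝ) ≤ r := by exact_mod_cast (Finset.mem_Icc.1 hj).2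
        have h4 : j * α ≤ π / 2 := by
          rw [hα, mul_div_assoc', div_le_div_iff₀ hn0 two_pos]
          have : (j : ℝ) * k ≤ r * k := by gcongr
          nlinarith [pi_pos]
        have h5 := mul_le_sin (x := j * α) (by positivity) h4
        have h6 : 2 / π * (j * α) = 2 * (k / n) * j := by
          rw [hα]; field_simp
        rw [h6] at h5
        have := pow_le_pow_left₀ (by positivity) h5 2
        nlinarith
      have h4 := Finset.sum_le_sum h3
      rw [← Finset.mul_sum] at h4
      rw [h1]
      calc 8 / 3 * (r * k / n : ℝ) ^ 2 = (r : ℝ)⁻¹ * (8 * (k / n : ℝ) ^ 2 * (r ^ 3 / 3)) := by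
            field_simp
        _ ≤ (r : ℝ)⁻¹ * (8 * (k / n : ℝ) ^ 2 * ∑ j ∈ Finset.Icc 1 r, (j : ℝ) ^ 2) := by
            gcongr
            linarith [cube_le_three_mul_sum_sq r]
        _ ≤ _ := by gcongr
    have hpos : 0 < 8 / 3 * (r * k / n : ℝ) ^ 2 := by positivity
    refine ⟨hpos.trans_le h2, (inv_anti₀ hpos h2).trans ?_⟩
    have : (8 / 3 * (r * k / n : ℝ) ^ 2)⁻¹ = 3 / 8 * (((n : ℝ) / r) ^ 2 * ((k : ℝ) ^ 2)⁻¹) := by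
      field_simp
    rw [this]
    have : 0 ≤ ((n : ℝ) / r) ^ 2 * ((k : ℝ) ^ 2)⁻¹ := by positivity
    linarith
  · have hα2 : α ≤ π / 2 := by
      rw [hα, div_le_div_iff₀ hn0 two_pos]
      nlinarith [pi_pos]
    have h1 : 2 * (k / n) ≤ sin α := by
      have := mul_le_sin (x := α) (by positivity) hα2
      rwa [show 2 / π * α = 2 * (k / n) by rw [hα]; field_simp] at this
    have h2 := two_sin_mul_sum_cos α r
    have h3 : ∑ j ∈ Finset.Icc 1 r, cos (2 * j * α) = r * eigval n r k := by
      simp only [eigval, hang]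
      rw [mul_inv_cancel_left₀ hr0.ne']
    rw [h3] at h2
    have h4 := sin_le_one ((2 * r + 1) * α)
    have h5 : 1 ≤ r * sin α := by
      have : r * (2 * (k / n : ℝ)) ≤ r * sin α := by gcongr
      refine le_trans ?_ this
      rw [show r * (2 * (k / n : ℝ)) = 2 * (r * k) / n by ring, le_div_iff₀ hn0]
      linarith
    have h6 : eigval n r k ≤ 1 / 2 := by
      by_contra! hc
      have h7 : 0 < sin α := lt_of_lt_of_le (by positivity) h1
      have : sin α * r * (1 / 2) < sin α * r * eigval n r k := by gcongr
      nlinarith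
    refine ⟨by linarith, ?_⟩
    have : (1 - eigval n r k)⁻¹ ≤ 2 := by
      rw [inv_le_comm₀ (by linarith) (by norm_num)]
      linarith
    have : 0 ≤ ((n : ℝ) / r) ^ 2 / 2 * ((k : ℝ) ^ 2)⁻¹ := by positivity
    linarith

lemma inv_one_sub_eigval_le {n r k : ℕ} (hr : 0 < r) (hk : 1 ≤ k) (hkn : k < n) :
    0 < 1 - eigval n r k ∧ (1 - eigval n r k)⁻¹ ≤
      2 + ((n : ℝ) / r) ^ 2 / 2 * (((k : ℝ) ^ 2)⁻¹ + (((n - k : ℕ) : ℝ) ^ 2)⁻¹) := by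
  have h1 : 0 ≤ ((n : ℝ) / r) ^ 2 / 2 * ((k : ℝ) ^ 2)⁻¹ := by positivity
  have h2 : 0 ≤ ((n : ℝ) / r) ^ 2 / 2 * (((n - k : ℕ) : ℝ) ^ 2)⁻¹ := by positivity
  rcases le_or_gt (2 * k) n with h | h
  · obtain ⟨h3, h4⟩ := inv_one_sub_eigval_le_of_le_half hr hk h
    exact ⟨h3, by linarith⟩
  · obtain ⟨h3, h4⟩ := inv_one_sub_eigval_le_of_le_half (n := n) (k := n - k) hr (by omega)
      (by omega)
    rw [eigval_reflect hkn] at h3 h4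
    exact ⟨h3, by linarith⟩

/-- The nontrivial eigenvalues of the interaction matrix on `m + 1` sites, shifted to have
mean zero. -/
def shiftEig (m r : ℕ) (k : Fin m) : ℝ := eigval (m + 1) r (k + 1) + 1 / m

lemma sum_shiftEig {m r : ℕ} (hm : 0 < m) (hr : 0 < r) (hn : r < m + 1) :
    ∑ k, shiftEig m r k = 0 := by
  have h := sum_eigval hn
  rw [Fin.sum_univ_succ, Fin.val_zero, eigval_zero hr] at h
  simp only [Fin.val_succ] at h
  simp only [shiftEig, Finset.sum_add_distrib, Finset.sum_const, Finset.card_univ, Fintype.card_fin,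
    nsmul_eq_mul]
  have : (m : ℝ) ≠ 0 := by positivity
  field_simp
  linarith

lemma abs_shiftEig_le {m : ℕ} (hm : 0 < m) (r : ℕ) (k : Fin m) : |shiftEig m r k| ≤ 2 := by
  have h1 := abs_eigval_le (m + 1) r (k + 1)
  have h2 : (1 : ℝ) / m ≤ 1 := by
    rw [div_le_one (by positivity)]
    exact_mod_cast hm
  have h3 : (0 : ℝ) ≤ 1 / m := by positivity
  rw [shiftEig]
  rw [abs_le] at h1 ⊢
  constructor <;> linarith

lemma half_one_sub_eigval_le {m r : ℕ} (hm : 0 < m) (hr : 0 < r)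
    (h : 6 * (2 + (((m + 1 : ℕ) : ℝ) / r) ^ 2) ≤ m) (k : Fin m) :
    (1 - eigval (m + 1) r (k + 1)) / 2 ≤ 1 - ((m + 1 : ℕ) / m : ℝ) * shiftEig m r k := by
  have hm0 : (0 : ℝ) < m := by positivity
  obtain ⟨h1, h2⟩ := inv_one_sub_eigval_le (n := m + 1) (k := k + 1) hr (by omega) (by omega)
  have h3 : (((k + 1 : ℕ) : ℝ) ^ 2)⁻¹ ≤ 1 :=
    inv_le_one_of_one_le₀ (one_le_pow₀ (by exact_mod_cast (by omega : 1 ≤ (k : ℕ) + 1)))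
  have h4 : (((m + 1 - (k + 1) : ℕ) : ℝ) ^ 2)⁻¹ ≤ 1 :=
    inv_le_one_of_one_le₀ (one_le_pow₀ (by exact_mod_cast (by omega : 1 ≤ m + 1 - ((k : ℕ) + 1))))
  have h5 : 6 * (1 - eigval (m + 1) r (k + 1))⁻¹ ≤ m := by
    have h0 : 0 ≤ (((m + 1 : ℕ) : ℝ) / r) ^ 2 / 2 := by positivity
    have := mul_le_mul_of_nonneg_left (add_le_add h3 h4) h0
    linarith
  have h6 : 6 * (1 / m : ℝ) ≤ 1 - eigval (m + 1) r (k + 1) := by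
    rw [mul_inv_le_iff₀ h1] at h5
    rw [mul_one_div, div_le_iff₀ hm0]
    linarith
  have h7 := (abs_le.1 (abs_eigval_le (m + 1) r (k + 1))).2
  have h8 : (1 / m : ℝ) ≤ 1 := by
    rw [div_le_one hm0]; exact_mod_cast hm
  have h9 : (0 : ℝ) < 1 / m := by positivity
  have h10 : ((m + 1 : ℕ) / m : ℝ) = 1 + 1 / m := by push_cast; field_simp
  rw [h10, shiftEig]
  nlinarith

lemma sum_range_inv_sq_le (m : ℕ) : ∑ k ∈ Finset.range m, (((k + 1 : ℕ) : ℝ) ^ 2)⁻¹ ≤ 2 := by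
  rcases Nat.eq_zero_or_pos m with rfl | hm
  · simp
  have : ∑ k ∈ Finset.range m, (((k + 1 : ℕ) : ℝ) ^ 2)⁻¹ ≤ 2 - (m : ℝ)⁻¹ := by
    induction m, hm using Nat.le_induction with
    | base => norm_num
    | succ m hm ih =>
      rw [Finset.sum_range_succ]
      have hm0 : (0 : ℝ) < m := by positivity
      have : (((m + 1 : ℕ) : ℝ) ^ 2)⁻¹ ≤ (m : ℝ)⁻¹ - ((m + 1 : ℕ) : ℝ)⁻¹ := by
        push_cast
        rw [inv_sub_inv (by positivity) (by positivity), inv_eq_one_div,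
          div_le_div_iff₀ (by positivity) (by positivity)]
        nlinarith
      linarith
  have : (0 : ℝ) ≤ (m : ℝ)⁻¹ := by positivity
  linarith

lemma sum_shiftEig_div_le {m r : ℕ} (hm : 0 < m) (hr : 0 < r) (hn : 2 * r < m + 1)
    (h : 6 * (2 + (((m + 1 : ℕ) : ℝ) / r) ^ 2) ≤ m) :
    ∑ k, shiftEig m r k / (1 - ((m + 1 : ℕ) / m : ℝ) * shiftEig m r k) ≤
      56 * (((m + 1 : ℕ) : ℝ) / r) ^ 2 := by
  have hm0 : (0 : ℝ) < m := by positivity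
  set b : ℝ := (m + 1 : ℕ) / m with hb
  set q : ℝ := ((m + 1 : ℕ) : ℝ) / r with hq
  have hr0 : (0 : ℝ) < r := by positivity
  have hq1 : 2 ≤ q := by
    rw [hq, le_div_iff₀ hr0]
    exact_mod_cast hn.le
  have hb2 : b ≤ 2 := by
    rw [hb, div_le_iff₀ hm0]
    push_cast
    have : (1 : ℝ) ≤ m := by exact_mod_cast hm
    linarith
  have hb0 : 0 ≤ b := by positivity
  set P : Fin m → ℝ := fun k =>
    (((k + 1 : ℕ) : ℝ) ^ 2)⁻¹ + (((m + 1 - (k + 1) : ℕ) : ℝ) ^ 2)⁻¹ with hP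
  have hP0 : ∀ k, 0 ≤ P k := fun k => by positivity
  have hterm : ∀ k, shiftEig m r k / (1 - b * shiftEig m r k) ≤
      shiftEig m r k + (8 * shiftEig m r k ^ 2 + 8 * q ^ 2 * P k) := by
    intro k
    obtain ⟨h1, h2⟩ := inv_one_sub_eigval_le (n := m + 1) (k := k + 1) hr (by omega) (by omega)
    have h3 := half_one_sub_eigval_le hm hr h k
    rw [← hb] at h3
    have h4 : 0 < 1 - b * shiftEig m r k := by linarith
    have h5 : (1 - b * shiftEig m r k)⁻¹ ≤ 2 * (2 + q ^ 2 / 2 * P k) := by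
      calc _ ≤ ((1 - eigval (m + 1) r (k + 1)) / 2)⁻¹ := inv_anti₀ (by linarith) h3
        _ = 2 * (1 - eigval (m + 1) r (k + 1))⁻¹ := by rw [inv_div, div_eq_mul_inv]
        _ ≤ _ := by
          simp only [hP]
          linarith
    have h6 : shiftEig m r k / (1 - b * shiftEig m r k) =
        shiftEig m r k + b * shiftEig m r k ^ 2 * (1 - b * shiftEig m r k)⁻¹ := by
      rw [div_eq_mul_inv]
      linear_combination shiftEig m r k * mul_inv_cancel₀ h4.ne'
    have h7 : shiftEig m r k ^ 2 ≤ 4 := by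
      have := abs_shiftEig_le hm r k
      rw [← sq_abs]
      nlinarith [abs_nonneg (shiftEig m r k)]
    rw [h6]
    have h8 : b * shiftEig m r k ^ 2 * (1 - b * shiftEig m r k)⁻¹ ≤
        2 * shiftEig m r k ^ 2 * (2 * (2 + q ^ 2 / 2 * P k)) := by gcongr
    have h9 : shiftEig m r k ^ 2 * (q ^ 2 * P k) ≤ 4 * (q ^ 2 * P k) := by
      have := hP0 k
      gcongr
    linarith
  have hPsum : ∑ k, P k ≤ 4 := by
    have h1 : ∑ k : Fin m, (((k + 1 : ℕ) : ℝ) ^ 2)⁻¹ ≤ 2 := by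
      rw [Fin.sum_univ_eq_sum_range fun k => (((k + 1 : ℕ) : ℝ) ^ 2)⁻¹]
      exact sum_range_inv_sq_le m
    have h2 : ∑ k : Fin m, (((m + 1 - (k + 1) : ℕ) : ℝ) ^ 2)⁻¹ ≤ 2 := by
      rw [Fin.sum_univ_eq_sum_range fun k => (((m + 1 - (k + 1) : ℕ) : ℝ) ^ 2)⁻¹,
        ← Finset.sum_range_reflect]
      refine le_trans (le_of_eq (Finset.sum_congr rfl fun k hk => ?_)) (sum_range_inv_sq_le m)
      have := Finset.mem_range.1 hk
      congr 3
      omega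
    simp only [hP, Finset.sum_add_distrib]
    linarith
  have hsq : ∑ k, shiftEig m r k ^ 2 ≤ q + 2 := by
    have h1 := sum_eigval_sq hr hn
    rw [Fin.sum_univ_succ] at h1
    simp only [Fin.val_succ] at h1
    have h2 : ∀ k : Fin m, shiftEig m r k ^ 2 ≤
        2 * eigval (m + 1) r (k + 1) ^ 2 + 2 * (1 / m : ℝ) ^ 2 := by
      intro k
      rw [shiftEig]
      nlinarith [sq_nonneg (eigval (m + 1) r (k + 1) - 1 / m)]
    have h3 := Finset.sum_le_sum fun k (_ : k ∈ Finset.univ) => h2 k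
    rw [Finset.sum_add_distrib, ← Finset.mul_sum] at h3
    simp only [Finset.sum_const, Finset.card_univ, Fintype.card_fin, nsmul_eq_mul] at h3
    have h4 : (m : ℝ) * (2 * (1 / m) ^ 2) ≤ 2 := by
      have : (1 / m : ℝ) ≤ 1 := by
        rw [div_le_one hm0]; exact_mod_cast hm
      have h5 : (m : ℝ) * (2 * (1 / m) ^ 2) = 2 * (1 / m) := by field_simp
      linarith
    have h5 : ((m + 1 : ℕ) : ℝ) / (2 * r) = q / 2 := by rw [hq]; field_simp
    rw [h5] at h1
    nlinarith [sq_nonneg (eigval (m + 1) r ((0 : Fin (m + 1)) : ℕ))]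
  calc _ ≤ ∑ k, (shiftEig m r k + (8 * shiftEig m r k ^ 2 + 8 * q ^ 2 * P k)) :=
        Finset.sum_le_sum fun k _ => hterm k
    _ = 8 * ∑ k, shiftEig m r k ^ 2 + 8 * q ^ 2 * ∑ k, P k := by
        rw [Finset.sum_add_distrib, sum_shiftEig hm hr (by omega), Finset.sum_add_distrib,
          ← Finset.mul_sum, ← Finset.mul_sum, zero_add]
    _ ≤ 8 * (q + 2) + 8 * q ^ 2 * 4 := by gcongr
    _ ≤ _ := by nlinarith

/-- The unnormalized Gibbs expectation of `f`. -/
def gibbsInt (n r : ℕ) (f : (Fin n → ℝ) → ℝ) : ℝ :=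
  ∫ x, exp (-(Ham n r x) / Temp n x) * f x ∂(stdGauss n)

lemma measurable_Ham (n r : ℕ) : Measurable (Ham n r) := by
  unfold Ham
  fun_prop

lemma measurable_Temp (n : ℕ) : Measurable (Temp n) := by
  unfold Temp
  fun_prop

lemma measurable_Mag (n : ℕ) : Measurable (Mag n) := by
  unfold Mag
  fun_prop

lemma integral_preμ {n : ℕ} (hn : 0 < n) (r : ℕ) (f : (Fin n → ℝ) → ℝ) :
    ∫ x, f x ∂(preμ n r) = gibbsInt n r f := by
  have h1 := measurable_Ham n r
  have h2 := measurable_Temp n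
  rw [preμ, integral_withDensity_eq_integral_toReal_smul, gibbsInt]
  · change ∫ x, _ ∂(stdGauss n) = _
    refine integral_congr_ae ?_
    filter_upwards [stdGauss_ae_ne_zero hn] with x hx
    have : 0 < Temp n x := div_pos (normSq_pos hx) (by positivity)
    simp [this, (exp_pos _).le]
  · exact Measurable.ite (measurableSet_lt measurable_const h2) (by fun_prop) measurable_const
  · refine ae_of_all _ fun x => ?_
    split_ifs <;> simp

lemma integral_μmeas {n : ℕ} (hn : 0 < n) (r : ℕ) (f : (Fin n → ℝ) → ℝ) :
    ∫ x, f x ∂(μmeas n r) = gibbsInt n r f / gibbsInt n r 1 := by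
  rw [μmeas, integral_smul_measure, integral_preμ hn, ← integral_preμ hn r 1]
  simp only [Pi.one_apply, integral_const, smul_eq_mul, mul_one, ENNReal.toReal_inv,
    Measure.real]
  rw [inv_mul_eq_div]

lemma integral_gaussianReal_scale {R : ℝ} (hR : 0 < R) (g : ℝ → ℝ) :
    ∫ y, g y ∂(gaussianReal 0 1) =
      (√(2 * π))⁻¹ * ∫ z, √R * exp (-(R / 2) * z ^ 2) * g (√R * z) := by
  rw [integral_gaussianReal_eq_integral_smul one_ne_zero]
  have h := Measure.integral_comp_mul_left (fun y => gaussianPDFReal 0 1 y • g y) √R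
  have hs : 0 < √R := sqrt_pos.2 hR
  rw [abs_of_pos (inv_pos.2 hs), smul_eq_mul, eq_comm, inv_mul_eq_iff_eq_mul₀ hs.ne'] at h
  rw [h, ← integral_const_mul, ← integral_const_mul]
  refine integral_congr_ae (ae_of_all _ fun z => ?_)
  have e : -(√R * z) ^ 2 / 2 = -(R / 2) * z ^ 2 := by
    rw [mul_pow, sq_sqrt hR.le]; ring
  simp only [gaussianPDFReal, sub_zero, NNReal.coe_one, mul_one, smul_eq_mul, e]
  ring

/-- The contribution of the constant mode `y`, given the Rayleigh quotient `l` and the squared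
norm `R` of the other modes. -/
def modeWeight (m : ℕ) (y l R : ℝ) : ℝ :=
  exp ((m + 1 : ℕ) * ((y ^ 2 + R * (l - 1 / m)) / (y ^ 2 + R)) / 2)

lemma modeWeight_le {m : ℕ} (hm : 0 < m) {y l R : ℝ} (hl : |l| ≤ 2) (hR : 0 ≤ R) :
    modeWeight m y l R ≤ exp ((m + 1 : ℕ) * 3 / 2) := by
  rw [modeWeight, exp_le_exp]
  have h1 : (0 : ℝ) < 1 / m := by positivity
  have : (y ^ 2 + R * (l - 1 / m)) / (y ^ 2 + R) ≤ 3 := by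
    refine div_le_of_le_mul₀ (by positivity) (by norm_num) ?_
    have h2 : R * (l - 1 / m) ≤ R * 2 := by
      gcongr
      linarith [(abs_le.1 hl).2]
    nlinarith [sq_nonneg y]
  gcongr

lemma modeWeight_scale {m : ℕ} (hm : 0 < m) {R : ℝ} (hR : 0 < R) (z l : ℝ) :
    modeWeight m (√R * z) l R = exp ((m + 1 : ℕ) / 2) *
      (exp (-((m + 1 : ℕ) * ((m + 1 : ℕ) / m) / 2 * (1 + z ^ 2)⁻¹)) *
        exp ((m + 1 : ℕ) * (1 + z ^ 2)⁻¹ / 2 * l)) := by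
  have h1 : (1 : ℝ) + z ^ 2 ≠ 0 := by positivity
  have h2 : (m : ℝ) ≠ 0 := by positivity
  have h3 : R * z ^ 2 + R ≠ 0 := by positivity
  rw [modeWeight, ← exp_add, ← exp_add, mul_pow, sq_sqrt hR.le]
  congr 1
  push_cast
  field_simp
  ring

lemma gibbsInt_hartley {m r : ℕ} (hr : 0 < r) (hn : r < m + 1) (hm : 0 < m)
    {ψ : ℝ → ℝ} (hψ : Measurable ψ) :
    gibbsInt (m + 1) r (fun x => ψ (Mag (m + 1) x)) =
      ∫ p : ℝ × (Fin m → ℝ), modeWeight m p.1 (rayleigh (shiftEig m r) p.2) (normSq p.2) *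
        ψ (√(m + 1 : ℕ) * p.1) ∂((gaussianReal 0 1).prod (stdGauss m)) := by
  have h1 := measurable_Ham (m + 1) r
  have h2 := measurable_Temp (m + 1)
  have h3 := measurable_Mag (m + 1)
  have hmp := measurePreserving_hartleyMap (m + 1)
  have hsplit := measurePreserving_piFinSuccAbove (fun _ : Fin (m + 1) => gaussianReal 0 1) 0
  have hmeas : Measurable fun x => exp (-(Ham (m + 1) r x) / Temp (m + 1) x) *
      ψ (Mag (m + 1) x) := by fun_prop
  rw [gibbsInt]
  nth_rw 1 [← hmp.map_eq]
  rw [integral_map hmp.measurable.aemeasurable hmeas.aestronglyMeasurable]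
  have h4 := hsplit.integral_comp' (g := fun p : ℝ × (Fin m → ℝ) =>
    modeWeight m p.1 (rayleigh (shiftEig m r) p.2) (normSq p.2) * ψ (√(m + 1 : ℕ) * p.1))
  rw [stdGauss, stdGauss, ← h4]
  refine integral_congr_ae (ae_of_all _ fun y => ?_)
  simp only [MeasurableEquiv.piFinSuccAbove_apply, Fin.insertNthEquiv_zero, Mag_hartleyMap]
  congr 1
  rw [modeWeight, neg_Ham_hartleyMap hn]
  have h5 : Temp (m + 1) (hartleyMap (m + 1) y) = normSq y / (m + 1 : ℕ) := by
    rw [← normSq_hartleyMap y]; rfl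
  have h6 : normSq y = y 0 ^ 2 + normSq (Fin.tail y) := by
    rw [normSq, Fin.sum_univ_succ]; rfl
  have h7 : ∑ k : Fin (m + 1), eigval (m + 1) r k * y k ^ 2 = y 0 ^ 2 + normSq (Fin.tail y) *
      (rayleigh (shiftEig m r) (Fin.tail y) - 1 / m) := by
    rw [mul_sub, mul_comm (normSq _) (rayleigh _ _), rayleigh_mul_normSq, Fin.sum_univ_succ,
      Fin.val_zero, eigval_zero hr, one_mul, normSq, Finset.sum_mul, ← Finset.sum_sub_distrib]
    congr 1
    refine Finset.sum_congr rfl fun k _ => ?_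
    rw [shiftEig, Fin.tail, Fin.val_succ]
    ring
  rw [h5, h7, h6]
  congr 1
  have : ((m + 1 : ℕ) : ℝ) ≠ 0 := by positivity
  simp only [Fin.consEquiv_symm_apply]
  rw [div_div_eq_mul_div]
  ring

lemma integrable_prod_gaussian_kernel {m : ℕ} (hm : 0 < m) :
    Integrable (fun p : (Fin m → ℝ) × ℝ => √(normSq p.1) * exp (-(normSq p.1 / 2) * p.2 ^ 2))
      ((stdGauss m).prod volume) := by
  have hN := measurable_normSq (m := m)
  rw [integrable_prod_iff (by fun_prop)]
  constructor
  · filter_upwards [stdGauss_ae_ne_zero hm] with w hw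
    exact (integrable_exp_neg_mul_sq (half_pos (normSq_pos hw))).const_mul _
  · refine (integrable_const √(2 * π)).congr ?_
    filter_upwards [stdGauss_ae_ne_zero hm] with w hw
    have hw' := normSq_pos hw
    simp only [norm_mul, norm_of_nonneg (sqrt_nonneg _), norm_of_nonneg (exp_pos _).le]
    rw [integral_const_mul, integral_gaussian, ← sqrt_mul hw'.le]
    congr 1
    field_simp

lemma integral_modeWeight {m : ℕ} (hm : 0 < m) {ev : Fin m → ℝ} (hev : ∀ k, |ev k| ≤ 2)
    {ψ : ℝ → ℝ} (hψ : Measurable ψ) {B : ℝ} (hB : ∀ x, |ψ x| ≤ B) :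
    ∫ p : ℝ × (Fin m → ℝ), modeWeight m p.1 (rayleigh ev p.2) (normSq p.2) * ψ p.1
      ∂((gaussianReal 0 1).prod (stdGauss m)) =
    (√(2 * π))⁻¹ * exp ((m + 1 : ℕ) / 2) *
      ∫ z, exp (-((m + 1 : ℕ) * ((m + 1 : ℕ) / m) / 2 * (1 + z ^ 2)⁻¹)) *
        rayMGF ev ((m + 1 : ℕ) * (1 + z ^ 2)⁻¹ / 2) *
        ∫ R, √R * exp (-(R / 2) * z ^ 2) * ψ (√R * z) ∂(chiSq m) := by
  have hN := measurable_normSq (m := m)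
  have hray := measurable_rayleigh ev
  have hB0 : 0 ≤ B := (abs_nonneg _).trans (hB 0)
  set C := exp ((m + 1 : ℕ) * 3 / 2 : ℝ)
  have hwt : ∀ y w, modeWeight m y (rayleigh ev w) (normSq w) ≤ C := fun y w =>
    modeWeight_le hm (abs_rayleigh_le zero_le_two hev w) (normSq_nonneg w)
  have hwt0 : ∀ y l R, 0 ≤ modeWeight m y l R := fun _ _ _ => (exp_pos _).le
  have hbd : ∀ y w x, ‖modeWeight m y (rayleigh ev w) (normSq w) * ψ x‖ ≤ C * B := fun y w x => by
    rw [norm_mul, norm_of_nonneg (hwt0 _ _ _)]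
    exact mul_le_mul (hwt y w) (hB x) (norm_nonneg _) (exp_pos _).le
  have hi : Integrable (fun p : ℝ × (Fin m → ℝ) =>
      modeWeight m p.1 (rayleigh ev p.2) (normSq p.2) * ψ p.1)
      ((gaussianReal 0 1).prod (stdGauss m)) := by
    refine Integrable.of_bound (C := C * B) ?_ (ae_of_all _ fun p => hbd _ _ _)
    simp only [modeWeight]
    fun_prop
  rw [integral_prod_symm _ hi]
  have hi2 : Integrable (Function.uncurry fun (w : Fin m → ℝ) (z : ℝ) => √(normSq w) *
      exp (-(normSq w / 2) * z ^ 2) * (modeWeight m (√(normSq w) * z) (rayleigh ev w) (normSq w) *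
        ψ (√(normSq w) * z))) ((stdGauss m).prod volume) := by
    refine ((integrable_prod_gaussian_kernel hm).mul_const (C * B)).mono' ?_
      (ae_of_all _ fun p => ?_)
    · simp only [modeWeight, Function.uncurry_def]
      fun_prop
    · simp only [Function.uncurry_def]
      rw [norm_mul, norm_of_nonneg (by positivity :
        0 ≤ √(normSq p.1) * exp (-(normSq p.1 / 2) * p.2 ^ 2))]
      gcongr
      exact hbd _ _ _
  calc _ = ∫ w, ((√(2 * π))⁻¹ * ∫ z, √(normSq w) * exp (-(normSq w / 2) * z ^ 2) *
        (modeWeight m (√(normSq w) * z) (rayleigh ev w) (normSq w) * ψ (√(normSq w) * z)))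
        ∂(stdGauss m) := by
        refine integral_congr_ae ?_
        filter_upwards [stdGauss_ae_ne_zero hm] with w hw
        exact integral_gaussianReal_scale (normSq_pos hw) fun y =>
          modeWeight m y (rayleigh ev w) (normSq w) * ψ y
    _ = (√(2 * π))⁻¹ * ∫ z, ∫ w, √(normSq w) * exp (-(normSq w / 2) * z ^ 2) *
        (modeWeight m (√(normSq w) * z) (rayleigh ev w) (normSq w) * ψ (√(normSq w) * z))
        ∂(stdGauss m) := by
        rw [integral_const_mul, integral_integral_swap hi2]
    _ = _ := by
        rw [mul_assoc, ← integral_const_mul (exp _)]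
        congr 1
        refine integral_congr_ae (ae_of_all _ fun z => ?_)
        simp only
        rw [rayMGF, mul_assoc, ← integral_prod_mul (fun l => exp (_ * l)) fun R => _,
          ← integral_rayleigh_normSq hm ev (by fun_prop), ← integral_const_mul,
            ← integral_const_mul]
        refine integral_congr_ae ?_
        filter_upwards [stdGauss_ae_ne_zero hm] with w hw
        rw [modeWeight_scale hm (normSq_pos hw)]
        ring

/-- The factor `1 / (1 + x² / √n)`. -/
def shrink (n : ℕ) (x : ℝ) : ℝ := (1 + x ^ 2 / √n)⁻¹

lemma shrink_pos (n : ℕ) (x : ℝ) : 0 < shrink n x := by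
  unfold shrink; positivity

lemma shrink_le_one (n : ℕ) (x : ℝ) : shrink n x ≤ 1 := by
  refine inv_le_one_of_one_le₀ ?_
  have : 0 ≤ x ^ 2 / √n := by positivity
  linarith

/-- The quartic factor, converging to `exp (-x⁴ / 4)`. -/
def quarticFactor (n : ℕ) (x : ℝ) : ℝ :=
  exp (n / 2 * (log (shrink n x) + (1 - shrink n x)))

/-- The average of `φ` over the fluctuations of the radial part. -/
def radialAvg (m : ℕ) (φ : ℝ → ℝ) (x : ℝ) : ℝ :=
  ∫ R, √(R / (m + 1 : ℕ)) * φ (√(R / (m + 1 : ℕ)) * (√(shrink (m + 1) x) * x)) ∂(chiSq m)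

/-- The contribution of the non-constant modes. -/
def modesFactor {m : ℕ} (ev : Fin m → ℝ) (x : ℝ) : ℝ :=
  exp (-((m + 1 : ℕ) / m / 2 * shrink (m + 1) x)) *
    (rayMGF ev ((m + 1 : ℕ) * shrink (m + 1) x / 2) / rayMGF ev ((m + 1 : ℕ) / 2))

lemma sqrt_shrink_pow (n : ℕ) (x : ℝ) :
    √(shrink n x) ^ n = exp (n / 2 * log (shrink n x)) := by
  rw [sqrt_eq_rpow, ← rpow_natCast, ← rpow_mul (shrink_pos n x).le,
    rpow_def_of_pos (shrink_pos n x)]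
  congr 1
  ring

lemma integral_radial {m : ℕ} {φ : ℝ → ℝ} (hφ : Measurable φ) (x : ℝ) {a : ℝ}
    (ha2 : a ^ 2 = 1 / √(m + 1 : ℕ)) {d : ℝ} (had : √(m + 1 : ℕ) * a / d = 1 / √(m + 1 : ℕ)) :
    ∫ R, √R * exp (-(R / 2) * (a * x) ^ 2) * φ (√(m + 1 : ℕ) * (√R * (a * x)) / d) ∂(chiSq m) =
      √(m + 1 : ℕ) * (√(shrink (m + 1) x) ^ (m + 1) * radialAvg m φ x) := by
  have hs := shrink_pos (m + 1) x
  have hc : 1 + (a * x) ^ 2 = (shrink (m + 1) x)⁻¹ := by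
    rw [shrink, inv_inv, mul_pow, ha2]
    ring
  have h := integral_chiSq_exp_mul (m := m) (c := √((shrink (m + 1) x)⁻¹)) (by positivity)
    (g := fun R => √R * φ (√(m + 1 : ℕ) * (√R * (a * x)) / d)) (by fun_prop)
  have hN : (0 : ℝ) < (m + 1 : ℕ) := by positivity
  rw [sq_sqrt (by positivity), ← hc] at h
  rw [radialAvg, pow_succ, ← integral_const_mul, ← integral_const_mul]
  refine Eq.trans (Eq.trans ?_ h) ?_
  · refine integral_congr_ae (ae_of_all _ fun R => ?_)
    have : -((1 + (a * x) ^ 2 - 1) * R / 2) = -(R / 2) * (a * x) ^ 2 := by ring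
    simp only [this]
    ring_nf
  · rw [hc, sqrt_inv, inv_inv, ← integral_const_mul]
    refine integral_congr_ae (ae_of_all _ fun R => ?_)
    have e1 : √(R / (shrink (m + 1) x)⁻¹) = √(m + 1 : ℕ) * (√(R / (m + 1 : ℕ)) *
        √(shrink (m + 1) x)) := by
      rw [div_inv_eq_mul, sqrt_mul' _ hs.le, ← mul_assoc, ← sqrt_mul hN.le,
        mul_div_cancel₀ _ hN.ne']
    have e2 : √(m + 1 : ℕ) * (√(R / (shrink (m + 1) x)⁻¹) * (a * x)) / d =
        √(R / (m + 1 : ℕ)) * (√(shrink (m + 1) x) * x) := by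
      rw [e1]
      have : √((m + 1 : ℕ) : ℝ) ≠ 0 := by positivity
      calc _ = √(m + 1 : ℕ) * a / d * (√(m + 1 : ℕ) * (√(R / (m + 1 : ℕ)) *
          √(shrink (m + 1) x)) * x) := by ring
        _ = _ := by rw [had]; field_simp
    beta_reduce
    rw [e2, e1]
    ring

/-- Up to a constant, the law of the rescaled magnetization has an explicit integral
representation. -/
lemma exists_gibbsInt_eq {m r : ℕ} (hr : 0 < r) (hn : r < m + 1) (hm : 0 < m) :
    ∃ C : ℝ, C ≠ 0 ∧ ∀ φ : BoundedContinuousFunction ℝ ℝ,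
      gibbsInt (m + 1) r (fun x => φ (Mag (m + 1) x / ((m + 1 : ℕ) : ℝ) ^ ((3 : ℝ) / 4))) =
        C * ∫ x, quarticFactor (m + 1) x * modesFactor (shiftEig m r) x * radialAvg m φ x := by
  set N : ℝ := ((m + 1 : ℕ) : ℝ) with hNdef
  have hN : 0 < N := by positivity
  have hm0 : (0 : ℝ) < m := by positivity
  set ev := shiftEig m r
  have h0 : ∑ k, ev k = 0 := sum_shiftEig hm hr hn
  have hF : 0 < rayMGF ev (N / 2) := lt_of_lt_of_le one_pos (one_le_rayMGF hm h0 _)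
  set a : ℝ := N ^ (-(1 / 4) : ℝ)
  have ha : 0 < a := by positivity
  have hsq : 1 / √N = N ^ (-(1 / 2) : ℝ) := by
    rw [rpow_neg hN.le, ← sqrt_eq_rpow, inv_eq_one_div]
  have ha2 : a ^ 2 = 1 / √N := by
    rw [← rpow_natCast, ← rpow_mul hN.le, hsq]
    norm_num
  have had : √N * a / N ^ ((3 : ℝ) / 4) = 1 / √N := by
    rw [hsq, sqrt_eq_rpow, ← rpow_add hN, ← rpow_sub hN]
    norm_num
  refine ⟨(√(2 * π))⁻¹ * (a * √N * rayMGF ev (N / 2)), by positivity, fun φ => ?_⟩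
  have hφ : Measurable φ := φ.continuous.measurable
  rw [gibbsInt_hartley hr hn hm (ψ := fun y => φ (y / N ^ ((3 : ℝ) / 4))) (by fun_prop),
    integral_modeWeight hm (abs_shiftEig_le hm r) (ψ := fun y => φ (√N * y / N ^ ((3 : ℝ) / 4)))
      (by fun_prop) (B := ‖φ‖) fun x => φ.norm_coe_le_norm _]
  rw [mul_assoc, mul_assoc]
  congr 1
  have hsub := fun g : ℝ → ℝ => Measure.integral_comp_mul_left g a
  simp only [abs_of_pos (inv_pos.2 ha), smul_eq_mul, eq_inv_mul_iff_mul_eq₀ ha.ne'] at hsub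
  rw [← hsub, ← integral_const_mul, ← integral_const_mul, ← integral_const_mul]
  refine integral_congr_ae (ae_of_all _ fun x => ?_)
  have hc : (1 + (a * x) ^ 2)⁻¹ = shrink (m + 1) x := by
    rw [shrink, mul_pow, ha2]
    congr 2
    rw [one_div_mul_eq_div]
  simp only [hc]
  rw [integral_radial hφ x ha2 had, sqrt_shrink_pow, quarticFactor, modesFactor]
  have hexp : exp (N / 2) * (exp (-(N * (N / m) / 2 * shrink (m + 1) x)) *
      exp (N / 2 * log (shrink (m + 1) x))) =
      exp (N / 2 * (log (shrink (m + 1) x) + (1 - shrink (m + 1) x))) *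
        exp (-(N / m / 2 * shrink (m + 1) x)) := by
    rw [← exp_add, ← exp_add, ← exp_add]
    congr 1
    have : N = m + 1 := by push_cast [hNdef]; ring
    rw [this]
    field_simp
    ring
  have hratio : rayMGF ev (N / 2) * (rayMGF ev (N * shrink (m + 1) x / 2) / rayMGF ev (N / 2)) =
      rayMGF ev (N * shrink (m + 1) x / 2) := mul_div_cancel₀ _ hF.ne'
  linear_combination (a * √N * rayMGF ev (N * shrink (m + 1) x / 2) * radialAvg m φ x) * hexp -
    (a * √N * exp (N / 2 * (log (shrink (m + 1) x) + (1 - shrink (m + 1) x))) *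
      exp (-(N / m / 2 * shrink (m + 1) x)) * radialAvg m φ x) * hratio

lemma quarticFactor_pos (n : ℕ) (x : ℝ) : 0 < quarticFactor n x := exp_pos _

lemma log_one_sub_le {u : ℝ} (hu : 0 ≤ u) (hu1 : u < 1) :
    log (1 - u) ≤ -(u + u ^ 2 / 2 + u ^ 3 / 3) := by
  have h := hasSum_pow_div_log_of_abs_lt_one (x := u) (by rwa [abs_of_nonneg hu])
  have := sum_le_hasSum (Finset.range 3) (fun i _ => by positivity) h
  norm_num [Finset.sum_range_succ] at this
  linarith

lemma one_sub_shrink (n : ℕ) (x : ℝ) :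
    1 - shrink n x = x ^ 2 / √n / (1 + x ^ 2 / √n) := by
  have : (0 : ℝ) < 1 + x ^ 2 / √n := by positivity
  rw [shrink]
  field_simp
  ring

lemma quarticFactor_le {n : ℕ} (hn : 64 ≤ n) (x : ℝ) :
    quarticFactor n x ≤ exp (-(x ^ 4 / 16)) + (1 + x ^ 2)⁻¹ := by
  have hn' : (64 : ℝ) ≤ n := by exact_mod_cast hn
  have hs8 : 8 ≤ √(n : ℝ) := by
    rw [le_sqrt' (by norm_num)]; linarith
  have hs0 : 0 < √(n : ℝ) := by linarith
  have hsq : √(n : ℝ) ^ 2 = n := sq_sqrt (by positivity)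
  set s := √(n : ℝ) with hs
  set t : ℝ := x ^ 2 / s with ht
  have ht0 : 0 ≤ t := by positivity
  have hu := one_sub_shrink n x
  have hp := shrink_pos n x
  have hp1 := shrink_le_one n x
  set u := 1 - shrink n x with hudef
  have hsh : shrink n x = 1 - u := by rw [hudef]; ring
  have hlog := log_one_sub_le (u := u) (by linarith) (by linarith)
  have hu0 : 0 ≤ u := by linarith
  have hu1 : u < 1 := by linarith
  rw [quarticFactor, hsh]
  rcases le_total t 1 with h | h
  · have h2 : t / 2 ≤ u := by
      rw [hu]; gcongr; linarith
    have h3 : (n : ℝ) * t ^ 2 = x ^ 4 := by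
      rw [ht, ← hsq]; field_simp
    have h4 : (t / 2) ^ 2 ≤ u ^ 2 := by gcongr
    have : exp (n / 2 * (log (1 - u) + (1 - (1 - u)))) ≤ exp (-(x ^ 4 / 16)) := by
      refine exp_le_exp.2 ?_
      rw [← h3]
      have : 0 ≤ u ^ 3 := by positivity
      nlinarith
    have : 0 ≤ (1 + x ^ 2)⁻¹ := by positivity
    linarith
  · have h2 : 1 / 2 ≤ u := by
      rw [hu, div_le_div_iff₀ (by norm_num) (by positivity)]; linarith
    have h3 : log (1 - u) + (1 - (1 - u)) ≤ log (1 - u) / 4 := by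
      nlinarith [mul_nonneg hu0 (sub_nonneg.2 h2),
        mul_nonneg (mul_nonneg hu0 hu0) (sub_nonneg.2 h2)]
    have h4 : log (1 - u) = -log (1 + t) := by
      rw [← hsh, shrink, log_inv]
    have h5 : 1 + x ^ 2 ≤ (1 + t) ^ s := by
      have := one_add_mul_self_le_rpow_one_add (s := t) (by linarith) (p := s) (by linarith)
      rwa [ht, mul_div_cancel₀ _ hs0.ne', ← ht] at this
    have h6 : log (1 + x ^ 2) ≤ s * log (1 + t) := by
      rw [← log_rpow (by linarith)]
      exact log_le_log (by positivity) h5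
    have h7 : 0 ≤ log (1 + t) := log_nonneg (by linarith)
    have : exp (n / 2 * (log (1 - u) + (1 - (1 - u)))) ≤ (1 + x ^ 2)⁻¹ := by
      rw [← exp_log (show (0:ℝ) < (1 + x ^ 2)⁻¹ by positivity), log_inv]
      refine exp_le_exp.2 ?_
      rw [h4] at h3 ⊢
      rw [← hsq]
      nlinarith [mul_le_mul_of_nonneg_left h3 (sq_nonneg s),
        mul_nonneg (mul_nonneg hs0.le (sub_nonneg.2 hs8)) h7]
    have := exp_pos (-(x ^ 4 / 16))
    linarith

lemma tendsto_shrink (x : ℝ) : Tendsto (fun n : ℕ => shrink n x) atTop (𝓝 1) := by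
  have h : Tendsto (fun n : ℕ => x ^ 2 / √(n : ℝ)) atTop (𝓝 0) :=
    (tendsto_sqrt_atTop.comp tendsto_natCast_atTop_atTop).const_div_atTop _
  simpa [shrink] using (h.const_add 1).inv₀ (by norm_num)

lemma tendsto_quarticFactor (x : ℝ) :
    Tendsto (fun n : ℕ => quarticFactor n x) atTop (𝓝 (exp (-(x ^ 4) / 4))) := by
  refine (continuous_exp.tendsto _).comp ?_
  have hs := tendsto_shrink x
  have h2 : Tendsto (fun n : ℕ => (n : ℝ) * (1 - shrink n x) ^ 2) atTop (𝓝 (x ^ 4)) := by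
    have : Tendsto (fun n : ℕ => x ^ 4 * shrink n x ^ 2) atTop (𝓝 (x ^ 4 * 1 ^ 2)) :=
      (hs.pow 2).const_mul _
    rw [one_pow, mul_one] at this
    refine this.congr' ?_
    filter_upwards [eventually_gt_atTop 0] with n hn
    have hn : (0 : ℝ) < n := by exact_mod_cast hn
    rw [one_sub_shrink, shrink]
    have : 0 < 1 + x ^ 2 / √(n : ℝ) := by positivity
    rw [div_pow, inv_pow, div_pow, sq_sqrt hn.le]
    field_simp
  have h3 : Tendsto (fun n : ℕ => (n : ℝ) * (1 - shrink n x) ^ 2 *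
      ((1 - shrink n x) / (1 - (1 - shrink n x)))) atTop (𝓝 0) := by
    have h := (tendsto_const_nhds (x := (1 : ℝ))).sub hs
    rw [sub_self] at h
    simpa using h2.mul (h.div ((tendsto_const_nhds (x := (1 : ℝ))).sub h) (by norm_num))
  have h4 : Tendsto (fun n : ℕ => (n : ℝ) / 2 * (log (shrink n x) + (1 - shrink n x)) -
      (-((n : ℝ) * (1 - shrink n x) ^ 2) / 4)) atTop (𝓝 0) := by
    refine squeeze_zero_norm (fun n => ?_) h3
    have hp := shrink_pos n x
    have hp1 := shrink_le_one n x
    set u := 1 - shrink n x with hudef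
    have hsh : shrink n x = 1 - u := by rw [hudef]; ring
    have h := abs_log_sub_add_sum_range_le (x := u) (by rw [abs_of_nonneg] <;> linarith) 2
    rw [abs_of_nonneg (a := u) (by linarith)] at h
    norm_num [Finset.sum_range_succ] at h
    have hn : (0 : ℝ) ≤ n := by positivity
    rw [hsh, norm_eq_abs, show (n : ℝ) / 2 * (log (1 - u) + u) - -(n * u ^ 2) / 4 =
      n / 2 * (u + u ^ 2 / 2 + log (1 - u)) by ring, abs_mul, abs_of_nonneg (by positivity)]
    have h0 : 0 ≤ n * (u ^ 3 / (1 - u)) := by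
      have : 0 ≤ u := by linarith
      have : 0 ≤ 1 - u := by linarith
      positivity
    calc _ ≤ (n : ℝ) / 2 * (u ^ 3 / (1 - u)) := by gcongr
      _ ≤ n * (u ^ 3 / (1 - u)) := by linarith
      _ = _ := by ring
  have := h4.add (h2.neg.div_const 4)
  simpa using this

lemma le_rayMGF_ratio {m r : ℕ} (hm : 0 < m) (hr : 0 < r) (hn : 2 * r < m + 1)
    (h : 6 * (2 + (((m + 1 : ℕ) : ℝ) / r) ^ 2) ≤ m) {K T : ℝ} (hK : 0 ≤ K)
    (hK6 : 6 * K ≤ √(m + 1 : ℕ)) (hT : (m + 1 : ℕ) * (1 - 2 * K / √(m + 1 : ℕ)) / 2 ≤ T) :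
    exp (-((2 + 6 * K) * 28 * ((((m + 1 : ℕ) : ℝ) / r) ^ 2 / √(m + 1 : ℕ)))) - exp (-(K ^ 2)) ≤
      rayMGF (shiftEig m r) T / rayMGF (shiftEig m r) ((m + 1 : ℕ) / 2) := by
  have hm0 : (0 : ℝ) < m := by positivity
  have hm1 : (1 : ℝ) ≤ m := by exact_mod_cast hm
  have hNm : ((m + 1 : ℕ) : ℝ) = m + 1 := by push_cast; ring
  have hN0 : (0 : ℝ) < (m + 1 : ℕ) := by positivity
  set N : ℝ := ((m + 1 : ℕ) : ℝ)
  have hs0 : 0 < √N := sqrt_pos.2 hN0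
  have hsN : √N ^ 2 = N := sq_sqrt hN0.le
  have hs1 : 1 ≤ √N := one_le_sqrt.2 (by linarith)
  set s := √N
  set ev := shiftEig m r
  have h0 : ∑ k, ev k = 0 := sum_shiftEig hm hr (by omega)
  have hF : 0 < rayMGF ev (N / 2) := lt_of_lt_of_le one_pos (one_le_rayMGF hm h0 _)
  have hks : 6 * (K / s) ≤ 1 := by
    rw [← mul_div_assoc, div_le_one hs0]; exact hK6
  have hks0 : 0 ≤ K / s := by positivity
  set η := K / s with hη
  have hηs : η * s = K := div_mul_cancel₀ _ hs0.ne'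
  have hb : ∀ k, N / m * ev k < 1 := fun k => by
    have h1 := half_one_sub_eigval_le hm hr h k
    have h2 := (inv_one_sub_eigval_le (n := m + 1) (k := k + 1) hr (by omega) (by omega)).1
    linarith
  have hb1 : N / m = 1 + 1 / m := by rw [hNm]; field_simp
  have hinv : (1 : ℝ) / m ≤ 2 / s := by
    rw [div_le_div_iff₀ hm0 hs0]
    nlinarith
  have key := rayMGF_ratio hm h0 (a := 1 - 6 * η) (b := N / m) (η := η) (X := N * (1 + 4 * η))
    (by linarith) (by positivity) hks0 (by linarith)
    (by
      have : (0 : ℝ) < 1 / m := by positivity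
      rw [hb1, div_le_iff₀ (by linarith)]
      nlinarith)
    hb (sum_shiftEig_div_le hm hr hn h)
  rw [div_mul_cancel₀ _ hm0.ne'] at key
  rw [le_div_iff₀ hF]
  have hmono : rayMGF ev ((1 - 6 * η) * (N * (1 + 4 * η)) / 2) ≤ rayMGF ev T := by
    refine rayMGF_mono hm h0 ?_ (le_trans ?_ hT)
    · have : 0 ≤ 1 - 6 * η := by linarith
      positivity
    · rw [mul_div_assoc 2, ← hη]
      nlinarith [mul_nonneg hN0.le (sq_nonneg η)]
  refine le_trans (mul_le_mul_of_nonneg_right (sub_le_sub ?_ ?_) hF.le) (key.trans hmono)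
  · refine exp_le_exp.2 (neg_le_neg ?_)
    have h1 : N / m - (1 - 6 * η) ≤ (2 + 6 * K) / s := by
      rw [hb1, add_div, mul_div_assoc 6, ← hη]
      linarith
    calc (N / m - (1 - 6 * η)) / 2 * (56 * (N / r) ^ 2)
        ≤ (2 + 6 * K) / s / 2 * (56 * (N / r) ^ 2) := by gcongr
      _ = _ := by ring
  · refine (mul_le_mul_of_nonneg_left (inv_sqrt_one_sub_pow_le m ?_) (exp_pos _).le).trans ?_
    · rw [abs_of_nonneg hks0]; linarith
    · rw [← exp_add]
      refine exp_le_exp.2 ?_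
      have h1 : N * η ^ 2 = K ^ 2 := by rw [← hηs, ← hsN]; ring
      have h2 : (m : ℝ) = N - 1 := by linarith
      rw [h2, ← h1]
      nlinarith [sq_nonneg η]

lemma tendsto_range_ratio {r : ℕ → ℕ}
    (hrange : Tendsto (fun n : ℕ => (r n : ℝ) / (n : ℝ) ^ ((3 : ℝ) / 4)) atTop atTop) :
    Tendsto (fun m : ℕ => (((m + 1 : ℕ) : ℝ) / r (m + 1)) ^ 2 / √(m + 1 : ℕ)) atTop (𝓝 0) := by
  have h := (hrange.inv_tendsto_atTop.pow 2).comp (tendsto_add_atTop_nat 1)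
  rw [zero_pow two_ne_zero] at h
  refine h.congr fun m => ?_
  have hN : (0 : ℝ) < (m + 1 : ℕ) := by positivity
  simp only [Function.comp_apply, Pi.inv_apply, inv_div, div_pow]
  rw [div_right_comm, ← rpow_natCast (_ ^ ((3 : ℝ) / 4)), ← rpow_mul hN.le, sqrt_eq_rpow,
    ← rpow_natCast ((m + 1 : ℕ) : ℝ), ← rpow_sub hN]
  norm_num

lemma eventually_range_le {r : ℕ → ℕ}
    (hrange : Tendsto (fun n : ℕ => (r n : ℝ) / (n : ℝ) ^ ((3 : ℝ) / 4)) atTop atTop) :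
    ∀ᶠ m : ℕ in atTop, 6 * (2 + (((m + 1 : ℕ) : ℝ) / r (m + 1)) ^ 2) ≤ m := by
  filter_upwards [(tendsto_range_ratio hrange).eventually_le_const (show (0:ℝ) < 1 by norm_num),
    eventually_ge_atTop 100] with m hm h100
  have hN : (100 : ℝ) ≤ m := by exact_mod_cast h100
  have hs : √((m + 1 : ℕ) : ℝ) ^ 2 = m + 1 := by
    rw [sq_sqrt (by positivity)]; push_cast; ring
  have hs0 : 10 ≤ √((m + 1 : ℕ) : ℝ) := by
    rw [le_sqrt' (by norm_num)]; push_cast; linarith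
  rw [div_le_one (by linarith)] at hm
  nlinarith

lemma tendsto_rayMGF_ratio {r : ℕ → ℕ} (hr : ∀ n, 3 ≤ n → 0 < 2 * r n ∧ 2 * r n < n)
    (hrange : Tendsto (fun n : ℕ => (r n : ℝ) / (n : ℝ) ^ ((3 : ℝ) / 4)) atTop atTop) (x : ℝ) :
    Tendsto (fun m : ℕ => rayMGF (shiftEig m (r (m + 1))) ((m + 1 : ℕ) * shrink (m + 1) x / 2) /
      rayMGF (shiftEig m (r (m + 1))) ((m + 1 : ℕ) / 2)) atTop (𝓝 1) := by
  refine tendsto_order.2 ⟨fun a ha => ?_, fun a ha => ?_⟩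
  · have hK : Tendsto (fun K : ℝ => 1 - exp (-(K ^ 2))) atTop (𝓝 (1 - 0)) :=
      (tendsto_exp_neg_atTop_nhds_zero.comp (tendsto_pow_atTop two_ne_zero)).const_sub 1
    rw [sub_zero] at hK
    obtain ⟨K, hKa, hK0, hKx⟩ := ((hK.eventually_const_lt ha).and
      ((eventually_ge_atTop 0).and (eventually_ge_atTop (x ^ 2 / 2)))).exists
    have hlim : Tendsto (fun m : ℕ => exp (-((2 + 6 * K) * 28 *
        ((((m + 1 : ℕ) : ℝ) / r (m + 1)) ^ 2 / √(m + 1 : ℕ)))) - exp (-(K ^ 2))) atTop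
        (𝓝 (1 - exp (-(K ^ 2)))) := by
      have := (continuous_exp.tendsto _).comp
        ((tendsto_range_ratio hrange).const_mul ((2 + 6 * K) * 28)).neg
      rw [mul_zero, neg_zero, exp_zero] at this
      exact this.sub_const _
    have hsq : Tendsto (fun m : ℕ => √((m + 1 : ℕ) : ℝ)) atTop atTop :=
      tendsto_sqrt_atTop.comp (tendsto_natCast_atTop_atTop.comp (tendsto_add_atTop_nat 1))
    filter_upwards [hlim.eventually_const_lt hKa, eventually_range_le hrange,
      hsq.eventually_ge_atTop (6 * K), eventually_ge_atTop 2] with m h1 h2 h3 h4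
    obtain ⟨hr1, hr2⟩ := hr (m + 1) (by omega)
    refine h1.trans_le (le_rayMGF_ratio (by omega) (by omega) hr2 h2 hK0 h3 ?_)
    refine div_le_div_of_nonneg_right (mul_le_mul_of_nonneg_left ?_ (by positivity)) zero_le_two
    have h5 := one_sub_shrink (m + 1) x
    have h6 : x ^ 2 / √((m + 1 : ℕ) : ℝ) / (1 + x ^ 2 / √((m + 1 : ℕ) : ℝ)) ≤
        x ^ 2 / √((m + 1 : ℕ) : ℝ) :=
      div_le_self (by positivity) (le_add_of_nonneg_right (by positivity))
    have h7 : x ^ 2 / √((m + 1 : ℕ) : ℝ) ≤ 2 * K / √((m + 1 : ℕ) : ℝ) := by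
      gcongr; linarith
    linarith
  · filter_upwards [eventually_ge_atTop 2] with m hm
    obtain ⟨hr1, hr2⟩ := hr (m + 1) (by omega)
    refine lt_of_le_of_lt ?_ ha
    have h0 := sum_shiftEig (m := m) (r := r (m + 1)) (by omega) (by omega) (by omega)
    rw [div_le_one (lt_of_lt_of_le one_pos (one_le_rayMGF (by omega) h0 _))]
    have := shrink_pos (m + 1) x
    refine rayMGF_mono (by omega) h0 (by positivity) ?_
    gcongr
    exact mul_le_of_le_one_right (by positivity) (shrink_le_one _ _)

lemma modesFactor_nonneg {m : ℕ} (ev : Fin m → ℝ) (x : ℝ) : 0 ≤ modesFactor ev x :=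
  mul_nonneg (exp_pos _).le (div_nonneg (rayMGF_nonneg _ _) (rayMGF_nonneg _ _))

lemma modesFactor_le_one {m : ℕ} (hm : 0 < m) {ev : Fin m → ℝ} (h0 : ∑ k, ev k = 0) (x : ℝ) :
    modesFactor ev x ≤ 1 := by
  have := shrink_pos (m + 1) x
  refine mul_le_one₀ (exp_le_one_iff.2 (neg_nonpos.2 (by positivity)))
    (div_nonneg (rayMGF_nonneg _ _) (rayMGF_nonneg _ _)) ?_
  rw [div_le_one (lt_of_lt_of_le one_pos (one_le_rayMGF hm h0 _))]
  refine rayMGF_mono hm h0 (by positivity) ?_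
  gcongr
  exact mul_le_of_le_one_right (by positivity) (shrink_le_one _ _)

lemma tendsto_modesFactor {r : ℕ → ℕ} (hr : ∀ n, 3 ≤ n → 0 < 2 * r n ∧ 2 * r n < n)
    (hrange : Tendsto (fun n : ℕ => (r n : ℝ) / (n : ℝ) ^ ((3 : ℝ) / 4)) atTop atTop) (x : ℝ) :
    Tendsto (fun m : ℕ => modesFactor (shiftEig m (r (m + 1))) x) atTop (𝓝 (exp (-(1 / 2)))) := by
  have h1 : Tendsto (fun m : ℕ => ((m + 1 : ℕ) : ℝ) / m) atTop (𝓝 1) := by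
    have := (tendsto_const_nhds (x := (1 : ℝ))).add
      (tendsto_const_div_atTop_nhds_zero_nat (1 : ℝ))
    rw [add_zero] at this
    refine this.congr' ?_
    filter_upwards [eventually_gt_atTop 0] with m hm
    have : (m : ℝ) ≠ 0 := by positivity
    push_cast
    field_simp
  have h2 := (tendsto_shrink x).comp (tendsto_add_atTop_nat 1)
  have h3 := (continuous_exp.tendsto _).comp ((h1.div_const 2).mul h2).neg
  have := h3.mul (tendsto_rayMGF_ratio hr hrange x)
  rw [mul_one, mul_one] at this
  exact this

@[fun_prop]
lemma measurable_shrink (n : ℕ) : Measurable (shrink n) := by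
  unfold shrink; fun_prop

lemma measurable_radialAvg (m : ℕ) {φ : ℝ → ℝ} (hφ : Measurable φ) :
    Measurable (radialAvg m φ) := by
  have h : Measurable fun p : ℝ × ℝ =>
      √(p.2 / (m + 1 : ℕ)) * φ (√(p.2 / (m + 1 : ℕ)) * (√(shrink (m + 1) p.1) * p.1)) := by
    fun_prop
  exact (StronglyMeasurable.integral_prod_right' (ν := chiSq m) h.stronglyMeasurable).measurable

lemma measurable_quarticFactor (n : ℕ) : Measurable (quarticFactor n) := by
  unfold quarticFactor; fun_prop

lemma measurable_modesFactor {m : ℕ} (ev : Fin m → ℝ) : Measurable (modesFactor ev) := by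
  have := measurable_rayMGF ev
  unfold modesFactor
  fun_prop

lemma integrable_radial {m : ℕ} (φ : BoundedContinuousFunction ℝ ℝ) (y : ℝ) :
    Integrable (fun R => √(R / (m + 1 : ℕ)) * φ (√(R / (m + 1 : ℕ)) * y)) (chiSq m) := by
  have hφ := φ.continuous.measurable
  refine Integrable.mono' (g := fun R => (1 + |R|) * ‖φ‖)
    (((integrable_const _).add (integrable_id_chiSq m).abs).mul_const _)
    (by fun_prop) (ae_of_all _ fun R => ?_)
  rw [norm_mul, norm_of_nonneg (sqrt_nonneg _)]
  refine mul_le_mul ?_ (φ.norm_coe_le_norm _) (norm_nonneg _) (by positivity)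
  rw [sqrt_le_iff]
  refine ⟨by positivity, ?_⟩
  have h1 : R / ((m + 1 : ℕ) : ℝ) ≤ |R| / ((m + 1 : ℕ) : ℝ) := by gcongr; exact le_abs_self R
  have h2 : |R| / ((m + 1 : ℕ) : ℝ) ≤ |R| :=
    div_le_self (abs_nonneg _) (by exact_mod_cast Nat.le_add_left 1 m)
  nlinarith [abs_nonneg R]

lemma abs_radialAvg_le {m : ℕ} (hm : 0 < m) (φ : BoundedContinuousFunction ℝ ℝ) (x : ℝ) :
    |radialAvg m φ x| ≤ ‖φ‖ := by
  have hN : (0 : ℝ) < (m + 1 : ℕ) := by positivity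
  have hint : Integrable (fun R : ℝ => (1 + R / (m + 1 : ℕ)) / 2 * ‖φ‖) (chiSq m) :=
    (((integrable_const _).add ((integrable_id_chiSq m).div_const _)).div_const _).mul_const _
  rw [← norm_eq_abs, radialAvg]
  refine (norm_integral_le_of_norm_le hint ?_).trans ?_
  · filter_upwards [chiSq_ae_pos hm] with R hR
    rw [norm_mul, norm_of_nonneg (sqrt_nonneg _)]
    have h1 := sq_sqrt (show 0 ≤ R / ((m + 1 : ℕ) : ℝ) by positivity)
    refine mul_le_mul ?_ (φ.norm_coe_le_norm _) (norm_nonneg _) (by positivity)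
    nlinarith [sq_nonneg (√(R / ((m + 1 : ℕ) : ℝ)) - 1)]
  · rw [integral_mul_const, integral_div, integral_add (integrable_const _)
      ((integrable_id_chiSq m).div_const _), integral_div, integral_id_chiSq]
    simp only [integral_const, probReal_univ, smul_eq_mul, one_mul]
    refine mul_le_of_le_one_left (norm_nonneg _) ?_
    have : (m : ℝ) / (m + 1 : ℕ) ≤ 1 := by
      rw [div_le_one hN]; push_cast; linarith
    linarith

lemma sq_sqrt_sub_one_le {m : ℕ} {R : ℝ} (hR : 0 < R) :
    (√(R / (m + 1 : ℕ)) - 1) ^ 2 ≤ (2 * (R - m) ^ 2 + 2) / ((m + 1 : ℕ) : ℝ) ^ 2 := by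
  have hN : (0 : ℝ) < (m + 1 : ℕ) := by positivity
  have h1 := sq_sqrt (show 0 ≤ R / ((m + 1 : ℕ) : ℝ) by positivity)
  have h0 := sqrt_nonneg (R / ((m + 1 : ℕ) : ℝ))
  set ρ := √(R / ((m + 1 : ℕ) : ℝ))
  have h2 : (ρ - 1) ^ 2 ≤ (ρ ^ 2 - 1) ^ 2 := by
    have : (ρ ^ 2 - 1) ^ 2 = (ρ - 1) ^ 2 * (ρ + 1) ^ 2 := by ring
    rw [this]
    exact le_mul_of_one_le_right (sq_nonneg _) (one_le_pow₀ (by linarith))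
  refine h2.trans ?_
  have h3 : ρ ^ 2 - 1 = (R - m - 1) / (m + 1 : ℕ) := by
    rw [h1]; field_simp; push_cast; ring
  rw [h3, div_pow]
  gcongr
  nlinarith [sq_nonneg (R - m + 1)]

lemma tendsto_radialAvg (φ : BoundedContinuousFunction ℝ ℝ) (x : ℝ) :
    Tendsto (fun m : ℕ => radialAvg m φ x) atTop (𝓝 (φ x)) := by
  rw [Metric.tendsto_nhds]
  intro ε' hε'
  set B := ‖φ‖ with hB
  have hB0 : 0 ≤ B := norm_nonneg φ
  obtain ⟨ε, hε, hεB⟩ : ∃ ε > 0, (B + 1) * ε < ε' :=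
    ⟨ε' / (2 * (B + 1)), by positivity, by field_simp; linarith⟩
  obtain ⟨δ, hδ, hδφ⟩ := Metric.continuous_iff.1 φ.continuous x ε hε
  set C : ℝ := B / ε + 4 * B * x ^ 2 / δ ^ 2 with hC
  have hC0 : 0 ≤ C := by positivity
  have hy : Tendsto (fun m : ℕ => √(shrink (m + 1) x) * x) atTop (𝓝 x) := by
    have := ((continuous_sqrt.tendsto _).comp
      ((tendsto_shrink x).comp (tendsto_add_atTop_nat 1))).mul_const x
    rwa [sqrt_one, one_mul] at this
  have hlim : Tendsto (fun m : ℕ => ((B + 1) * ε + 4 * B / δ ^ 2 *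
      (√(shrink (m + 1) x) * x - x) ^ 2) + C * (130 / (m + 1 : ℕ))) atTop
      (𝓝 ((B + 1) * ε)) := by
    have h1 : Tendsto (fun m : ℕ => (130 : ℝ) / (m + 1 : ℕ)) atTop (𝓝 0) :=
      (tendsto_natCast_atTop_atTop.comp (tendsto_add_atTop_nat 1)).const_div_atTop _
    have h2 := (((hy.sub_const x).pow 2).const_mul (4 * B / δ ^ 2)).const_add ((B + 1) * ε)
    simpa using h2.add (h1.const_mul C)
  filter_upwards [hlim.eventually_lt_const hεB, eventually_gt_atTop 0] with m h1 hm
  refine lt_of_le_of_lt ?_ h1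
  have hN : (0 : ℝ) < (m + 1 : ℕ) := by positivity
  have hNm : ((m + 1 : ℕ) : ℝ) = m + 1 := by push_cast; ring
  have hsh0 := shrink_pos (m + 1) x
  have hsh1 := shrink_le_one (m + 1) x
  rw [dist_eq_norm]
  have hconst : φ x = ∫ _, φ x ∂(chiSq m) := by simp
  rw [radialAvg, hconst, ← integral_sub (integrable_radial φ _) (integrable_const _)]
  set y := √(shrink (m + 1) x) * x with hydef
  have hyx : y ^ 2 ≤ x ^ 2 := by
    rw [hydef, mul_pow, sq_sqrt hsh0.le]
    exact mul_le_of_le_one_left (sq_nonneg _) hsh1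
  set A : ℝ := (B + 1) * ε + 4 * B / δ ^ 2 * (y - x) ^ 2
  have hint : Integrable (fun R : ℝ => (2 * (R - m) ^ 2 + 2) / ((m + 1 : ℕ) : ℝ) ^ 2) (chiSq m) :=
    (((integrable_sq_centered_chiSq hm).const_mul 2).add (integrable_const _)).div_const _
  refine (norm_integral_le_of_norm_le ((integrable_const A).add (hint.const_mul C)) ?_).trans ?_
  · filter_upwards [chiSq_ae_pos hm] with R hR
    refine le_trans ?_ (add_le_add_right (mul_le_mul_of_nonneg_left
      (sq_sqrt_sub_one_le hR) hC0) A)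
    set ρ := √(R / ((m + 1 : ℕ) : ℝ))
    have h2 : |ρ - 1| ≤ ε + (ρ - 1) ^ 2 / ε := by
      rw [← sub_le_iff_le_add', le_div_iff₀ hε, ← sq_abs (ρ - 1)]
      nlinarith [sq_nonneg (|ρ - 1| - ε), abs_nonneg (ρ - 1)]
    have h3 : |φ (ρ * y) - φ x| ≤ ε + 2 * B / δ ^ 2 * (ρ * y - x) ^ 2 := by
      rcases lt_or_ge (dist (ρ * y) x) δ with h | h
      · have h4 := hδφ _ h
        rw [dist_eq] at h4
        have : 0 ≤ 2 * B / δ ^ 2 * (ρ * y - x) ^ 2 := by positivity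
        linarith
      · rw [dist_eq] at h
        have h4 : |φ (ρ * y) - φ x| ≤ 2 * B := by
          have := (norm_sub_le (φ (ρ * y)) (φ x)).trans
            (add_le_add (φ.norm_coe_le_norm _) (φ.norm_coe_le_norm _))
          rw [norm_eq_abs] at this
          linarith
        have h5 : 2 * B ≤ 2 * B / δ ^ 2 * (ρ * y - x) ^ 2 := by
          rw [div_mul_eq_mul_div, le_div_iff₀ (by positivity), ← sq_abs (ρ * y - x)]
          gcongr
        linarith
    have h4 : (ρ * y - x) ^ 2 ≤ 2 * (x ^ 2 * (ρ - 1) ^ 2) + 2 * (y - x) ^ 2 := by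
      nlinarith [sq_nonneg ((ρ - 1) * y - (y - x)),
        mul_le_mul_of_nonneg_right hyx (sq_nonneg (ρ - 1))]
    have h5 : |φ (ρ * y)| ≤ B := φ.norm_coe_le_norm _
    calc ‖ρ * φ (ρ * y) - φ x‖ = |(ρ - 1) * φ (ρ * y) + (φ (ρ * y) - φ x)| := by
          rw [norm_eq_abs]; congr 1; ring
      _ ≤ |ρ - 1| * |φ (ρ * y)| + |φ (ρ * y) - φ x| := by
          rw [← abs_mul]; exact abs_add_le _ _
      _ ≤ (ε + (ρ - 1) ^ 2 / ε) * B + (ε + 2 * B / δ ^ 2 *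
            (2 * (x ^ 2 * (ρ - 1) ^ 2) + 2 * (y - x) ^ 2)) := by
          refine add_le_add (mul_le_mul h2 h5 (abs_nonneg _) (by positivity)) (h3.trans ?_)
          gcongr
      _ = _ := by simp only [A, C]; ring
  · simp only [Pi.add_apply]
    rw [integral_add (integrable_const A) (hint.const_mul C), integral_const_mul, integral_div,
      integral_add ((integrable_sq_centered_chiSq hm).const_mul 2) (integrable_const _),
      integral_const_mul]
    simp only [integral_const, probReal_univ, smul_eq_mul, one_mul]
    refine add_le_add_right (mul_le_mul_of_nonneg_left ?_ hC0) A
    rw [div_le_div_iff₀ (by positivity) hN]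
    have h2 := integral_sq_centered_chiSq_le hm
    have h3 : 2 * (∫ R, (R - m) ^ 2 ∂(chiSq m)) + 2 ≤ 130 * (m + 1 : ℕ) := by
      have : (0 : ℝ) ≤ m := by positivity
      rw [hNm]; linarith
    nlinarith

lemma integrable_exp_neg_mul_pow_four {b : ℝ} (hb : 0 < b) :
    Integrable fun x : ℝ => exp (-(b * x ^ 4)) := by
  refine ((integrable_exp_neg_mul_sq hb).const_mul (exp b)).mono' (by fun_prop)
    (ae_of_all _ fun x => ?_)
  rw [norm_of_nonneg (exp_pos _).le, ← exp_add]
  refine exp_le_exp.2 ?_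
  nlinarith [mul_nonneg hb.le (sq_nonneg (x ^ 2 - 1)), mul_nonneg hb.le (sq_nonneg x)]

lemma integral_exp_neg_pow_four : ∫ x : ℝ, exp (-(x ^ 4) / 4) = Gamma (1 / 4) / √2 := by
  have h1 := integral_comp_abs (f := fun x : ℝ => exp (-(x ^ 4) / 4))
  simp only [Even.pow_abs (by decide : Even 4)] at h1
  have h2 := integral_exp_neg_mul_rpow (p := 4) (b := 1 / 4) (by norm_num) (by norm_num)
  rw [h1]
  have h3 : ∫ x in Set.Ioi (0 : ℝ), exp (-(x ^ 4) / 4) =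
      ∫ x in Set.Ioi (0 : ℝ), exp (-(1 / 4) * x ^ (4 : ℝ)) := by
    refine integral_congr_ae (ae_of_all _ fun x => ?_)
    have : x ^ (4 : ℝ) = x ^ 4 := by exact_mod_cast rpow_natCast x 4
    simp only [this]
    congr 1
    ring
  have h4 : ((1 : ℝ) / 4) ^ (-1 / 4 : ℝ) = √2 := by
    rw [sqrt_eq_rpow, show (1 : ℝ) / 4 = 2 ^ (-2 : ℝ) by norm_num, ← rpow_mul (by norm_num)]
    norm_num
  have h5 : √(2 : ℝ) * √2 = 2 := mul_self_sqrt (by norm_num)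
  rw [h3, h2, h4, Gamma_add_one (by norm_num)]
  field_simp
  linarith

lemma tendsto_integral_factors {r : ℕ → ℕ} (hr : ∀ n, 3 ≤ n → 0 < 2 * r n ∧ 2 * r n < n)
    (hrange : Tendsto (fun n : ℕ => (r n : ℝ) / (n : ℝ) ^ ((3 : ℝ) / 4)) atTop atTop)
    (φ : BoundedContinuousFunction ℝ ℝ) :
    Tendsto (fun m : ℕ => ∫ x, quarticFactor (m + 1) x *
      modesFactor (shiftEig m (r (m + 1))) x * radialAvg m φ x) atTop
      (𝓝 (exp (-(1 / 2)) * ∫ x, exp (-(x ^ 4) / 4) * φ x)) := by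
  rw [← integral_const_mul]
  refine tendsto_integral_filter_of_dominated_convergence
    (fun x => (exp (-(1 / 16 * x ^ 4)) + (1 + x ^ 2)⁻¹) * ‖φ‖)
    (Eventually.of_forall fun m => ?_) ?_ ?_ (ae_of_all _ fun x => ?_)
  · exact (((measurable_quarticFactor _).mul (measurable_modesFactor _)).mul
      (measurable_radialAvg m φ.continuous.measurable)).aestronglyMeasurable
  · filter_upwards [eventually_ge_atTop 64] with m hm
    obtain ⟨hr1, hr2⟩ := hr (m + 1) (by omega)
    refine ae_of_all _ fun x => ?_
    have h1 := quarticFactor_le (n := m + 1) (by omega) x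
    rw [← one_div_mul_eq_div] at h1
    have h2 := modesFactor_le_one (by omega)
      (sum_shiftEig (m := m) (r := r (m + 1)) (by omega) (by omega) (by omega)) x
    have h3 := modesFactor_nonneg (shiftEig m (r (m + 1))) x
    rw [norm_mul, norm_mul, norm_of_nonneg (quarticFactor_pos _ _).le, norm_of_nonneg h3]
    have h4 := (quarticFactor_pos (m + 1) x).le
    exact mul_le_mul ((mul_le_of_le_one_right h4 h2).trans h1)
      (abs_radialAvg_le (by omega) φ x) (norm_nonneg _) (h4.trans h1)
  · exact ((integrable_exp_neg_mul_pow_four (by norm_num)).add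
      integrable_inv_one_add_sq).mul_const _
  · have := (((tendsto_quarticFactor x).comp (tendsto_add_atTop_nat 1)).mul
      (tendsto_modesFactor hr hrange x)).mul (tendsto_radialAvg φ x)
    rwa [mul_comm (exp _) (exp _), mul_assoc] at this

/-- **Theorem (long range case).** If `r_n / n^{3/4} → ∞`, then under `μ_n` the rescaled
magnetization `S_n / n^{3/4}` converges in distribution to the probability measure on `ℝ`
with density `x ↦ (√2 / Γ(1/4)) exp(-x⁴/4)`. -/
theorem long_range_self_critical
    (r : ℕ → ℕ) (hr : ∀ n, 3 ≤ n → 0 < 2 * r n ∧ 2 * r n < n)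
    (hrange : Tendsto (fun n : ℕ => (r n : ℝ) / (n : ℝ) ^ ((3 : ℝ) / 4)) atTop atTop) :
    ∀ φ : BoundedContinuousFunction ℝ ℝ,
      Tendsto (fun n : ℕ =>
          ∫ x, φ (Mag n x / (n : ℝ) ^ ((3 : ℝ) / 4)) ∂(μmeas n (r n))) atTop
        (𝓝 (∫ x, φ x ∂(volume.withDensity fun x : ℝ =>
            ENNReal.ofReal (Real.sqrt 2 / Real.Gamma (1 / 4) * Real.exp (-(x ^ 4) / 4))))) := by
  intro φ
  have hΓ : 0 < Gamma (1 / 4) := Gamma_pos_of_pos (by norm_num)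
  rw [← tendsto_add_atTop_iff_nat 1]
  have h1 := tendsto_integral_factors hr hrange 1
  simp only [BoundedContinuousFunction.coe_one, Pi.one_apply, mul_one,
    integral_exp_neg_pow_four] at h1
  have h2 := (tendsto_integral_factors hr hrange φ).div h1 (by positivity)
  have hlim : exp (-(1 / 2)) * (∫ x, exp (-(x ^ 4) / 4) * φ x) /
      (exp (-(1 / 2)) * (Gamma (1 / 4) / √2)) =
      ∫ x, φ x ∂(volume.withDensity fun x : ℝ =>
        ENNReal.ofReal (√2 / Gamma (1 / 4) * exp (-(x ^ 4) / 4))) := by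
    rw [integral_withDensity_eq_integral_toReal_smul (by fun_prop)
      (ae_of_all _ fun x => ENNReal.ofReal_lt_top), mul_div_mul_left _ _ (exp_pos _).ne',
      div_div_eq_mul_div, mul_comm, mul_div_right_comm, ← integral_const_mul]
    refine integral_congr_ae (ae_of_all _ fun x => ?_)
    simp only
    rw [ENNReal.toReal_ofReal (by positivity), smul_eq_mul, mul_assoc]
  rw [hlim] at h2
  refine h2.congr' ?_
  filter_upwards [eventually_ge_atTop 2] with m hm
  obtain ⟨hr1, hr2⟩ := hr (m + 1) (by omega)
  obtain ⟨C, hC, h⟩ := exists_gibbsInt_eq (m := m) (r := r (m + 1)) (by omega) (by omega) (by omega)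
  have hφ := h φ
  have h1' := h 1
  rw [integral_μmeas (by omega), hφ]
  refine Eq.trans ?_ (congrArg _ h1'.symm)
  rw [mul_div_mul_left _ _ hC]
  rfl

end
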